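/- For every ε > 0 and every positive integer Δ, there exists α = α(ε,Δ) > 0 such that the following holds for all sufficiently large n: every n-vertex graph G with minimum degree δ(G) ≥ εn and bipartite independence number α*(G) < αn is 𝒯(n,Δ)-universal, i.e., G contains every tree on n vertices with maximum degree at most Δ as a subgraph. -/

import Mathlib

section

section
open Finset
open scoped Classical

namespace ST

/-- neighbours of a vertex as a finset -/
noncomputable def nb {V : Type*} [Fintype V] (G : SimpleGraph V) (v : V) : Finset V :=
  univ.filter (fun u => G.Adj v u)

lemma mem_nb {V : Type*} [Fintype V] {G : SimpleGraph V} {v u : V} : u ∈ nb G v ↔ G.Adj v u := by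
  simp [nb]

/-- any two disjoint sets of size at least `s` are joined by an edge -/
def Joined {V : Type*} (G : SimpleGraph V) (s : ℕ) : Prop :=
  ∀ S T : Finset V, Disjoint S T → s ≤ S.card → s ≤ T.card → ∃ a ∈ S, ∃ b ∈ T, G.Adj a b

lemma Joined.two {V : Type*} {G : SimpleGraph V} {s : ℕ} (h : Joined G s) (S T : Finset V)
    (hS : s ≤ S.card) (hT : 2 * s ≤ T.card) : ∃ a ∈ S, ∃ b ∈ T, G.Adj a b := by
  obtain ⟨S', hS', hc⟩ := exists_subset_card_eq hS
  have h1 : T.card ≤ (T \ S').card + S'.card := by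
    have := le_card_sdiff S' T
    omega
  obtain ⟨a, ha, b, hb, hab⟩ := h S' (T \ S') disjoint_sdiff hc.ge (by omega)
  exact ⟨a, hS' ha, b, (mem_sdiff.1 hb).1, hab⟩

/-- connecting two vertices by a path of length three -/
lemma connect {V : Type*} [Fintype V] {G : SimpleGraph V} {s : ℕ} (h : Joined G s) (R F : Finset V)
    (x y : V) (hx : F.card + 2 * s ≤ (nb G x ∩ R).card) (hy : F.card + 2 * s ≤ (nb G y ∩ R).card) :
    ∃ a b, a ∈ R ∧ b ∈ R ∧ a ∉ F ∧ b ∉ F ∧ G.Adj x a ∧ G.Adj a b ∧ G.Adj b y := by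
  have h1 := le_card_sdiff F (nb G x ∩ R)
  have h2 := le_card_sdiff F (nb G y ∩ R)
  obtain ⟨a, ha, b, hb, hab⟩ := h.two ((nb G x ∩ R) \ F) ((nb G y ∩ R) \ F) (by omega) (by omega)
  simp only [mem_sdiff, mem_inter, mem_nb] at ha hb
  exact ⟨a, b, ha.1.2, hb.1.2, ha.2, hb.2, ha.1.1, hab, hb.1.1.symm⟩

/-- the vertices of `A` adjacent to some vertex of `X` -/
noncomputable def nbs {V : Type*} [Fintype V] (G : SimpleGraph V) (X A : Finset V) : Finset V :=
  A.filter (fun a => ∃ x ∈ X, G.Adj x a)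

lemma nbs_card_lt {V : Type*} [Fintype V] {G : SimpleGraph V} {s : ℕ} (h : Joined G s)
    (X A : Finset V) (hd : Disjoint X A) (hX : s ≤ X.card) : A.card < (nbs G X A).card + s := by
  by_contra hc
  push Not at hc
  have h1 := le_card_sdiff (nbs G X A) A
  obtain ⟨a, ha, b, hb, hab⟩ := h X (A \ nbs G X A)
    (hd.mono_right sdiff_subset) hX (by omega)
  rw [mem_sdiff] at hb
  exact hb.2 (mem_filter.2 ⟨hb.1, a, ha, hab⟩)

lemma min_deg {V : Type*} [Fintype V] {G : SimpleGraph V} {s K : ℕ} (h : Joined G s)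
    (A : Finset V) (hA : (K + 2) * s ≤ A.card) :
    ∃ A' ⊆ A, A.card < A'.card + s + 1 ∧ ∀ a ∈ A', K ≤ (nb G a ∩ A').card := by
  let P : Finset (Finset V) := A.powerset.filter
    (fun X => X.card ≤ s ∧ (nbs G X (A \ X)).card ≤ K * X.card)
  have hP : P.Nonempty := ⟨∅, mem_filter.2 ⟨by simp, by simp, by simp [nbs]⟩⟩
  obtain ⟨X, hX, hmax⟩ := exists_max_image P card hP
  simp only [P, mem_filter, mem_powerset] at hX
  obtain ⟨hXA, hXs, hXn⟩ := hX
  have hcard := card_sdiff_add_card_eq_card hXA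
  by_cases hs0 : s = 0
  · -- degenerate: the graph would have to be empty
    exfalso
    obtain ⟨a, ha, -⟩ := h ∅ ∅ (by simp) (by simp [hs0]) (by simp [hs0])
    simp at ha
  have hlt : X.card < s := by
    rcases hXs.lt_or_eq with h1 | h1
    · exact h1
    · exfalso
      have := nbs_card_lt h X (A \ X) disjoint_sdiff h1.ge
      rw [h1] at hXn hcard
      nlinarith
  refine ⟨A \ X, sdiff_subset, by omega, fun a ha => ?_⟩
  by_contra hc
  push Not at hc
  have haX := (mem_sdiff.1 ha).2
  have hc' : (insert a X).card = X.card + 1 := card_insert_of_notMem haX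
  have hin : insert a X ∈ P := by
    simp only [P, mem_filter, mem_powerset]
    refine ⟨insert_subset (mem_sdiff.1 ha).1 hXA, by omega, ?_⟩
    have hsub : nbs G (insert a X) (A \ insert a X) ⊆ nbs G X (A \ X) ∪ (nb G a ∩ (A \ X)) := by
      intro b hb
      simp only [nbs, mem_filter, mem_sdiff, mem_insert, mem_union, mem_inter, mem_nb] at hb ⊢
      obtain ⟨⟨hbA, hb2⟩, x, hx, hxb⟩ := hb
      push Not at hb2
      rcases hx with rfl | hx
      · exact Or.inr ⟨hxb, hbA, hb2.2⟩
      · exact Or.inl ⟨⟨hbA, hb2.2⟩, x, hx, hxb⟩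
    have := (card_le_card hsub).trans (card_union_le _ _)
    rw [hc']
    nlinarith
  have := hmax _ hin
  omega

lemma root_deg {V : Type*} [Fintype V] {G : SimpleGraph V} {s K : ℕ} (h : Joined G s)
    (R A : Finset V) (hd : Disjoint R A) (hR : s ≤ R.card) (hA : (K + 1) * s ≤ A.card) :
    ∃ r ∈ R, K ≤ (nb G r ∩ A).card := by
  by_contra hc
  push Not at hc
  obtain ⟨X, hX, hXc⟩ := exists_subset_card_eq hR
  have h1 := nbs_card_lt h X A (hd.mono_left hX) hXc.ge
  have hsub : nbs G X A ⊆ X.biUnion (fun r => nb G r ∩ A) := by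
    intro b hb
    simp only [nbs, mem_filter, mem_biUnion, mem_inter, mem_nb] at hb ⊢
    obtain ⟨hbA, x, hx, hxb⟩ := hb
    exact ⟨x, hx, hxb, hbA⟩
  have h2 := (card_le_card hsub).trans
    (card_biUnion_le_card_mul X _ K (fun r hr => (hc r (hX hr)).le))
  rw [hXc] at h2
  nlinarith

end ST

end

section
open Finset
open scoped Classical

set_option linter.unusedSectionVars false
namespace ST

/-- a rooted tree given by its parent function -/
structure RT (U : Type*) where
  root : U
  par : U → U
  dep : U → ℕ
  dep_par : ∀ v, v ≠ root → dep (par v) + 1 = dep v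
  dep_root : dep root = 0
  par_root : par root = root

/-- `f` embeds the part of the tree induced on `D` -/
def Emb {U V : Type*} (t : RT U) (G : SimpleGraph V) (D : Finset U) (f : U → V) : Prop :=
  Set.InjOn f D ∧ ∀ v ∈ D, v ≠ t.root → t.par v ∈ D → G.Adj (f v) (f (t.par v))

variable {U V : Type*} [Fintype U] [Fintype V]

/-- greedy embedding of a block -/
lemma block_greedy (t : RT U) (G : SimpleGraph V) (K : ℕ) (D : Finset U) (f : U → V)
    (hf : Emb t G D f) (c : U) (r : V) (A : Finset V)
    (hr : r ∉ D.image f) (hAr : r ∉ A) (hA : Disjoint A (D.image f))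
    (hrK : K ≤ (nb G r ∩ A).card) (hAK : ∀ a ∈ A, K ≤ (nb G a ∩ A).card)
    (hadj : G.Adj r (f (t.par c))) (hcD : c ∉ D) (n : ℕ) :
    ∀ B : Finset U, B.card = n → c ∈ B → Disjoint B D → B.card ≤ K →
      (∀ v ∈ B, v ≠ c → t.par v ∈ B ∧ v ≠ t.root) →
      (∀ v ∈ D, v ≠ t.root → t.par v ∉ B) → (c ≠ t.root → t.par c ∉ B) →
      ∃ f' : U → V, (∀ v, v ∉ B → f' v = f v) ∧ Emb t G (D ∪ B) f' ∧ f' c = r ∧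
        ∀ v ∈ B, v ≠ c → f' v ∈ A := by
  induction n with
  | zero =>
    intro B hB hc
    rw [card_eq_zero] at hB
    simp [hB] at hc
  | succ n ih =>
    intro B hB hcB hBD hBK hpar hDB hcp
    by_cases hB1 : B = {c}
    · subst hB1
      refine ⟨Function.update f c r, ?_, ?_, by simp, ?_⟩
      · intro v hv
        rw [Function.update_of_ne (by simpa using hv)]
      · constructor
        · intro x hx y hy hxy
          simp only [coe_union, coe_singleton, Set.mem_union, Set.mem_singleton_iff, mem_coe] at hx hy
          by_cases hxc : x = c <;> by_cases hyc : y = c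
          · rw [hxc, hyc]
          · have hyD : y ∈ D := by tauto
            subst hxc
            rw [Function.update_self, Function.update_of_ne hyc] at hxy
            exact absurd (mem_image_of_mem f hyD) (hxy ▸ hr)
          · have hxD : x ∈ D := by tauto
            subst hyc
            rw [Function.update_self, Function.update_of_ne hxc] at hxy
            exact absurd (mem_image_of_mem f hxD) (hxy ▸ hr)
          · rw [Function.update_of_ne hxc, Function.update_of_ne hyc] at hxy
            exact hf.1 (by tauto) (by tauto) hxy
        · intro v hv hvr hpv
          simp only [mem_union, mem_singleton] at hv hpv
          by_cases hvc : v = c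
          · subst hvc
            have := hcp hvr
            simp only [mem_singleton] at this
            rw [Function.update_self, Function.update_of_ne this]
            exact hadj
          · have hvD : v ∈ D := by tauto
            have h1 := hDB v hvD hvr
            simp only [mem_singleton] at h1
            rw [Function.update_of_ne hvc, Function.update_of_ne h1]
            exact hf.2 v hvD hvr (by tauto)
      · intro v hv hvc
        simp at hv
        exact absurd hv hvc
    · -- take the deepest vertex other than c
      have hne : (B.erase c).Nonempty := by
        rw [nonempty_iff_ne_empty]
        intro h
        apply hB1
        rw [← insert_erase hcB, h, insert_empty_eq]
      obtain ⟨b, hb, hbmax⟩ := exists_max_image (B.erase c) t.dep hne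
      have hbc : b ≠ c := (mem_erase.1 hb).1
      have hbB : b ∈ B := (mem_erase.1 hb).2
      have hnopar : ∀ v ∈ B, v ≠ t.root → v ≠ c → t.par v ≠ b := by
        intro v hv hvr hvc hpb
        have := hbmax v (mem_erase.2 ⟨hvc, hv⟩)
        have h2 := t.dep_par v hvr
        rw [hpb] at h2
        omega
      have hcard : (B.erase b).card = n := by rw [card_erase_of_mem hbB, hB]; rfl
      obtain ⟨f', hf'1, hf'2, hf'c, hf'A⟩ := ih (B.erase b) hcard (mem_erase.2 ⟨hbc.symm, hcB⟩)
        (hBD.mono_left (erase_subset _ _)) (by omega)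
        (fun v hv hvc => by
          have hvB := (mem_erase.1 hv).2
          have := hpar v hvB hvc
          exact ⟨mem_erase.2 ⟨hnopar v hvB this.2 hvc, this.1⟩, this.2⟩)
        (fun v hv hvr h => hDB v hv hvr (mem_erase.1 h).2)
        (fun hcr h => hcp hcr (mem_erase.1 h).2)
      have hbp := hpar b hbB hbc
      have hpbne : t.par b ≠ b := by
        intro h
        have := t.dep_par b hbp.2
        rw [h] at this
        omega
      set y := f' (t.par b) with hy
      have hyK : K ≤ (nb G y ∩ A).card := by
        by_cases hpc : t.par b = c
        · rw [hy, hpc, hf'c]; exact hrK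
        · exact hAK _ (hf'A _ (mem_erase.2 ⟨hpbne, hbp.1⟩) hpc)
      set Z := ((B.erase b).erase c).image f' with hZ
      have hZc : Z.card < K := by
        have h1 : Z.card ≤ ((B.erase b).erase c).card := card_image_le
        have h2 : ((B.erase b).erase c).card < (B.erase b).card :=
          card_erase_lt_of_mem (mem_erase.2 ⟨hbc.symm, hcB⟩)
        omega
      obtain ⟨x, hx⟩ : ((nb G y ∩ A) \ Z).Nonempty := by
        rw [← card_pos]
        have := le_card_sdiff Z (nb G y ∩ A)
        omega
      simp only [mem_sdiff, mem_inter, mem_nb] at hx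
      obtain ⟨⟨hyx, hxA⟩, hxZ⟩ := hx
      have hxD : ∀ v ∈ D ∪ B, v ≠ b → f' v ≠ x := by
        intro v hv hvb hvx
        by_cases hvB : v ∈ B
        · by_cases hvc : v = c
          · rw [hvc, hf'c] at hvx
            exact hAr (hvx ▸ hxA)
          · exact hxZ (hvx ▸ mem_image_of_mem f' (mem_erase.2 ⟨hvc, mem_erase.2 ⟨hvb, hvB⟩⟩))
        · have hvD : v ∈ D := (mem_union.1 hv).resolve_right hvB
          rw [hf'1 v (fun h => hvB (mem_erase.1 h).2)] at hvx
          exact (disjoint_left.1 hA hxA) (hvx ▸ mem_image_of_mem f hvD)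
      have hmem : ∀ v, v ∈ D ∪ B → v ≠ b → v ∈ D ∪ B.erase b := by
        intro v hv hvb
        simp only [mem_union, mem_erase] at hv ⊢
        tauto
      refine ⟨Function.update f' b x, ?_, ⟨?_, ?_⟩, ?_, ?_⟩
      · intro v hv
        rw [Function.update_of_ne (by rintro rfl; exact hv hbB)]
        exact hf'1 v (fun h => hv (mem_erase.1 h).2)
      · intro u hu v hv huv
        rw [mem_coe] at hu hv
        by_cases hub : u = b <;> by_cases hvb : v = b
        · rw [hub, hvb]
        · subst hub
          rw [Function.update_self, Function.update_of_ne hvb] at huv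
          exact absurd huv.symm (hxD v hv hvb)
        · subst hvb
          rw [Function.update_self, Function.update_of_ne hub] at huv
          exact absurd huv (hxD u hu hub)
        · rw [Function.update_of_ne hub, Function.update_of_ne hvb] at huv
          exact hf'2.1 (hmem u hu hub) (hmem v hv hvb) huv
      · intro v hv hvr hpv
        by_cases hvb : v = b
        · subst hvb
          rw [Function.update_self, Function.update_of_ne hpbne]
          exact hyx.symm
        · have hpvb : t.par v ≠ b := by
            intro hpb
            by_cases hvB : v ∈ B
            · by_cases hvc : v = c
              · subst hvc
                exact hcp hvr (hpb ▸ hbB)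
              · exact hnopar v hvB hvr hvc hpb
            · exact hDB v ((mem_union.1 hv).resolve_right hvB) hvr (hpb ▸ hbB)
          rw [Function.update_of_ne hvb, Function.update_of_ne hpvb]
          exact hf'2.2 v (hmem v hv hvb) hvr (hmem _ hpv hpvb)
      · rw [Function.update_of_ne hbc.symm]; exact hf'c
      · intro v hv hvc
        by_cases hvb : v = b
        · subst hvb; rw [Function.update_self]; exact hxA
        · rw [Function.update_of_ne hvb]
          exact hf'A v (mem_erase.2 ⟨hvb, hv⟩) hvc

end ST

end

section
open Finset
open scoped Classical

set_option linter.unusedSectionVars false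
namespace ST
variable {U V : Type*} [Fintype U] [Fintype V]

lemma RT.dep_par_lt (t : RT U) (v : U) (hv : v ≠ t.root) : t.dep (t.par v) < t.dep v := by
  have := t.dep_par v hv
  omega

lemma RT.par_ne (t : RT U) (v : U) (hv : v ≠ t.root) : t.par v ≠ v := by
  intro h
  have := t.dep_par v hv
  rw [h] at this
  omega

lemma Emb.update {t : RT U} {G : SimpleGraph V} {D : Finset U} {f : U → V} (hf : Emb t G D f)
    (v : U) (x : V) (hv : v ∉ D) (hx : x ∉ D.image f)
    (h1 : v ≠ t.root → t.par v ∈ D → G.Adj x (f (t.par v)))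
    (h2 : ∀ u ∈ D, u ≠ t.root → t.par u = v → G.Adj (f u) x) :
    Emb t G (insert v D) (Function.update f v x) := by
  constructor
  · intro a ha b hb hab
    simp only [coe_insert, Set.mem_insert_iff, mem_coe] at ha hb
    by_cases hav : a = v <;> by_cases hbv : b = v
    · rw [hav, hbv]
    · subst hav
      rw [Function.update_self, Function.update_of_ne hbv] at hab
      exact absurd (mem_image_of_mem f (hb.resolve_left hbv)) (hab ▸ hx)
    · subst hbv
      rw [Function.update_self, Function.update_of_ne hav] at hab
      exact absurd (mem_image_of_mem f (ha.resolve_left hav)) (hab ▸ hx)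
    · rw [Function.update_of_ne hav, Function.update_of_ne hbv] at hab
      exact hf.1 (ha.resolve_left hav) (hb.resolve_left hbv) hab
  · intro a ha har hpa
    rw [mem_insert] at ha hpa
    by_cases hav : a = v
    · subst hav
      have hne := t.par_ne a har
      rw [Function.update_self, Function.update_of_ne hne]
      exact h1 har (hpa.resolve_left hne)
    · by_cases hpv : t.par a = v
      · rw [Function.update_of_ne hav, hpv, Function.update_self]
        exact h2 a (ha.resolve_left hav) har hpv
      · rw [Function.update_of_ne hav, Function.update_of_ne hpv]
        exact hf.2 a (ha.resolve_left hav) har (hpa.resolve_left hpv)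

set_option maxHeartbeats 800000 in
theorem embed_cuts (t : RT U) (G : SimpleGraph V) (s K dR : ℕ) (hJ : Joined G s) (R : Finset V)
    (hR : ∀ v, dR ≤ (nb G v ∩ R).card) (D0 : Finset U) (f0 : U → V) (h0 : Emb t G D0 f0)
    (hR0 : Disjoint R (D0.image f0)) (blk : U → Finset U) (C : Finset U) :
    (∀ c ∈ C, Disjoint (blk c) D0) →
    (∀ c ∈ C, ∀ c' ∈ C, c ≠ c' → Disjoint (blk c) (blk c')) →
    (∀ c ∈ C, c ∈ blk c ∧ ∀ v ∈ blk c, t.dep c ≤ t.dep v ∧ (v ≠ c → t.par v ∈ blk c ∧ v ≠ t.root)) →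
    (∀ c ∈ C, ((blk c).card ≤ K ∧ ∀ v ∈ D0, v ≠ t.root → t.par v ∉ blk c) ∨
      (∃ c2 q, blk c = {c, c2} ∧ c2 ≠ c ∧ q ∈ D0 ∧ t.par q = c2 ∧
        ∀ v ∈ D0, v ≠ t.root → t.par v ∈ blk c → v = q)) →
    2 * C.card + 2 * s ≤ dR →
    (D0 ∪ C.biUnion blk).card + R.card + (K + 2) * s ≤ Fintype.card V →
    ∃ f : U → V, (∀ v ∈ D0, f v = f0 v) ∧ Emb t G (D0 ∪ C.biUnion blk) f ∧
      ((D0 ∪ C.biUnion blk).filter (fun v => f v ∈ R)).card ≤ 2 * C.card := by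
  induction C using Finset.induction_on_max_value t.dep with
  | empty =>
    intro _ _ _ _ _ _
    refine ⟨f0, fun _ _ => rfl, by simpa using h0, ?_⟩
    have : ((D0 ∪ (∅ : Finset U).biUnion blk).filter (fun v => f0 v ∈ R)) = ∅ := by
      rw [filter_eq_empty_iff]
      intro v hv hvR
      simp only [biUnion_empty, union_empty] at hv
      exact disjoint_left.1 hR0 hvR (mem_image_of_mem f0 hv)
    rw [this]; simp
  | insert c C hcC hmax ih =>
    intro hD hdisj hblk hkind hdR hcard
    have hcc : (insert c C).card = C.card + 1 := card_insert_of_notMem hcC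
    have hsubD : D0 ∪ C.biUnion blk ⊆ D0 ∪ (insert c C).biUnion blk :=
      union_subset_union_right (biUnion_subset_biUnion_of_subset_left _ (subset_insert _ _))
    have hle := card_le_card hsubD
    obtain ⟨f, hff0, hfE, hfR⟩ := ih (fun x hx => hD x (mem_insert_of_mem hx))
      (fun x hx y hy => hdisj x (mem_insert_of_mem hx) y (mem_insert_of_mem hy))
      (fun x hx => hblk x (mem_insert_of_mem hx)) (fun x hx => hkind x (mem_insert_of_mem hx))
      (by omega) (by omega)
    set D := D0 ∪ C.biUnion blk with hDdef
    have hDnew : D0 ∪ (insert c C).biUnion blk = D ∪ blk c := by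
      rw [hDdef, biUnion_insert]
      ext x; simp only [mem_union]; tauto
    rw [hDnew] at hcard ⊢
    have hBD : Disjoint (blk c) D := by
      rw [hDdef, disjoint_union_right, disjoint_biUnion_right]
      refine ⟨hD c (mem_insert_self _ _), fun c' hc' => ?_⟩
      exact hdisj c (mem_insert_self _ _) c' (mem_insert_of_mem hc') (by rintro rfl; exact hcC hc')
    obtain ⟨hcB, hBv⟩ := hblk c (mem_insert_self _ _)
    -- children of the new block which are already embedded lie in `D0`
    have hchild : ∀ v ∈ D, v ≠ t.root → t.par v ∈ blk c → v ∈ D0 := by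
      intro v hv hvr hpv
      by_contra hvD
      have hv2 := (mem_union.1 hv).resolve_left hvD
      obtain ⟨c', hc', hvc'⟩ := mem_biUnion.1 hv2
      obtain ⟨_, h2⟩ := hblk c' (mem_insert_of_mem hc')
      by_cases hvc : v = c'
      · subst hvc
        have h3 := (hBv _ hpv).1
        have h4 := t.dep_par_lt v hvr
        have h5 := hmax v hc'
        omega
      · have := (h2 v hvc').2 hvc
        exact disjoint_left.1 hBD hpv (mem_union_right _ (mem_biUnion.2 ⟨c', hc', this.1⟩))
    have hcpar : c ≠ t.root → t.par c ∉ blk c := by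
      intro hcr h
      have h3 := (hBv _ h).1
      have h4 := t.dep_par_lt c hcr
      omega
    -- the used part of the reserve
    set F := (D.filter (fun v => f v ∈ R)).image f with hF
    have hFc : F.card ≤ 2 * C.card := card_image_le.trans hfR
    have hFmem : ∀ x ∈ R, x ∉ F → x ∉ D.image f := by
      intro x hx hxF hxD
      obtain ⟨v, hv, rfl⟩ := mem_image.1 hxD
      exact hxF (mem_image_of_mem f (mem_filter.2 ⟨hv, hx⟩))
    have hcD : c ∉ D := disjoint_left.1 hBD hcB
    rcases hkind c (mem_insert_self _ _) with ⟨hBK, hDB⟩ | ⟨c2, q, hB2, hc2, hq, hpq, hqu⟩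
    · -- normal block
      set A := univ \ (R ∪ D.image f) with hA
      have hAc : (K + 2) * s ≤ A.card := by
        have h1 := le_card_sdiff (R ∪ D.image f) (univ : Finset V)
        have h2 := card_union_le R (D.image f)
        have h3 : (D.image f).card ≤ D.card := card_image_le
        have h4 : D.card ≤ (D ∪ blk c).card := card_le_card subset_union_left
        rw [card_univ, ← hA] at h1
        omega
      obtain ⟨A', hA'A, hA'c, hA'K⟩ := min_deg hJ A hAc
      set R' := (nb G (f (t.par c)) ∩ R) \ F with hR'
      have hR'c : s ≤ R'.card := by
        have h1 := le_card_sdiff F (nb G (f (t.par c)) ∩ R)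
        have h2 := hR (f (t.par c))
        rw [← hR'] at h1
        omega
      have hdisjRA : Disjoint R' A' := by
        rw [disjoint_left]
        intro x hx hxA
        have := hA'A hxA
        simp only [hA, mem_sdiff, mem_union] at this
        simp only [hR', mem_sdiff, mem_inter] at hx
        tauto
      obtain ⟨r, hr, hrK⟩ := root_deg hJ R' A' hdisjRA hR'c (K := K) (by nlinarith)
      have hr' := hr
      simp only [hR', mem_sdiff, mem_inter, mem_nb] at hr'
      obtain ⟨f', hf'1, hf'E, hf'c, hf'A⟩ := block_greedy t G K D f hfE c r A'
        (hFmem r hr'.1.2 hr'.2) (disjoint_left.1 hdisjRA hr)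
        (by
          rw [disjoint_left]
          intro x hx hxD
          have := hA'A hx
          simp only [hA, mem_sdiff, mem_union] at this
          tauto) hrK hA'K hr'.1.1.symm hcD _ (blk c) rfl hcB hBD hBK
        (fun v hv hvc => (hBv v hv).2 hvc)
        (fun v hv hvr hpv => hDB v (hchild v hv hvr hpv) hvr hpv) hcpar
      refine ⟨f', ?_, hf'E, ?_⟩
      · intro v hv
        rw [hf'1 v (fun h => disjoint_left.1 hBD h (mem_union_left _ hv)), hff0 v hv]
      · have hsub : (D ∪ blk c).filter (fun v => f' v ∈ R) ⊆
            insert c (D.filter (fun v => f v ∈ R)) := by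
          intro v hv
          rw [mem_filter] at hv
          obtain ⟨hv, hvR⟩ := hv
          by_cases hvB : v ∈ blk c
          · by_cases hvc : v = c
            · rw [hvc]; exact mem_insert_self _ _
            · exfalso
              have := hA'A (hf'A v hvB hvc)
              simp only [hA, mem_sdiff, mem_union] at this
              tauto
          · rw [hf'1 v hvB] at hvR
            exact mem_insert_of_mem (mem_filter.2 ⟨(mem_union.1 hv).resolve_right hvB, hvR⟩)
        have h1 := card_le_card hsub
        have h2 := card_insert_le c (D.filter (fun v => f v ∈ R))
        omega
    · -- connector block
      obtain ⟨a, b, haR, hbR, haF, hbF, hya, hab, hbx⟩ := connect hJ R F (f (t.par c)) (f q)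
        (by have := hR (f (t.par c)); omega) (by have := hR (f q); omega)
      have hqD : q ∈ D := mem_union_left _ hq
      have hc2B : c2 ∈ blk c := by rw [hB2]; simp
      have hc2D : c2 ∉ D := disjoint_left.1 hBD hc2B
      have hc2par : t.par c2 = c := by
        have h1 := (hBv c2 hc2B).2 hc2
        have h2 := t.par_ne c2 h1.2
        have h3 := h1.1
        rw [hB2] at h3
        simp only [mem_insert, mem_singleton] at h3
        tauto
      have hab' : a ≠ b := hab.ne
      have haD := hFmem a haR haF
      have hbD := hFmem b hbR hbF
      have hE1 := hfE.update c2 b hc2D hbD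
        (by rw [hc2par]; exact fun _ h => absurd h hcD)
        (by
          intro u hu hur hpu
          have hpu' : t.par u ∈ blk c := by rw [hpu]; exact hc2B
          have := hqu u (hchild u hu hur hpu') hur hpu'
          rw [this]; exact hbx.symm)
      have hE2 := hE1.update c a
        (by rw [mem_insert]; rintro (h | h); exacts [hc2 h.symm, hcD h])
        (by
          intro h
          obtain ⟨v, hv, hva⟩ := mem_image.1 h
          by_cases hvc : v = c2
          · rw [hvc, Function.update_self] at hva
            exact hab' hva.symm
          · rw [Function.update_of_ne hvc] at hva
            exact haD (hva ▸ mem_image_of_mem f ((mem_insert.1 hv).resolve_left hvc)))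
        (by
          intro hcr hpc
          have : t.par c ≠ c2 := fun h => hcpar hcr (h ▸ hc2B)
          rw [Function.update_of_ne this]
          exact hya.symm)
        (by
          intro u hu hur hpu
          rcases mem_insert.1 hu with rfl | hu
          · rw [Function.update_self]; exact hab.symm
          · exfalso
            have hpu' : t.par u ∈ blk c := by rw [hpu]; exact hcB
            have := hqu u (hchild u hu hur hpu') hur hpu'
            rw [this, hpq] at hpu
            exact hc2 hpu)
      have hset : D ∪ blk c = insert c (insert c2 D) := by
        rw [hB2, union_insert, union_singleton]
      rw [hset]
      refine ⟨_, ?_, hE2, ?_⟩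
      · intro v hv
        have hvD : v ∈ D := mem_union_left _ hv
        rw [Function.update_of_ne (by rintro rfl; exact hcD hvD),
          Function.update_of_ne (by rintro rfl; exact hc2D hvD), hff0 v hv]
      · have hsub : (insert c (insert c2 D)).filter
            (fun v => Function.update (Function.update f c2 b) c a v ∈ R) ⊆
            insert c (insert c2 (D.filter (fun v => f v ∈ R))) := by
          intro v hv
          rw [mem_filter] at hv
          obtain ⟨hv, hvR⟩ := hv
          by_cases hvc : v = c
          · simp [hvc]
          by_cases hvc2 : v = c2
          · simp [hvc2]
          rw [Function.update_of_ne hvc, Function.update_of_ne hvc2] at hvR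
          have hvD : v ∈ D := by
            rcases mem_insert.1 hv with h | h
            · exact absurd h hvc
            · exact (mem_insert.1 h).resolve_left hvc2
          exact mem_insert_of_mem (mem_insert_of_mem (mem_filter.2 ⟨hvD, hvR⟩))
        have h1 := card_le_card hsub
        have h2 := card_insert_le c (insert c2 (D.filter (fun v => f v ∈ R)))
        have h3 := card_insert_le c2 (D.filter (fun v => f v ∈ R))
        omega

end ST

end

section
open Finset
open scoped Classical

set_option linter.unusedSectionVars false
namespace ST
variable {U V : Type*} [Fintype U] [Fintype V]

/-- the children of a vertex -/
noncomputable def RT.ch (t : RT U) (v : U) : Finset U := univ.filter (fun u => u ≠ t.root ∧ t.par u = v)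

lemma RT.mem_ch {t : RT U} {u v : U} : u ∈ t.ch v ↔ u ≠ t.root ∧ t.par u = v := by
  simp [RT.ch]

lemma RT.dep_par' (t : RT U) (v : U) : t.dep (t.par v) = t.dep v - 1 := by
  by_cases h : v = t.root
  · rw [h, t.par_root, t.dep_root]
  · have := t.dep_par v h
    omega

lemma RT.dep_iter (t : RT U) (j : ℕ) (v : U) : t.dep (t.par^[j] v) = t.dep v - j := by
  induction j generalizing v with
  | zero => rfl
  | succ j ih => rw [Function.iterate_succ_apply, ih, t.dep_par']; omega

lemma RT.ne_root_of_dep (t : RT U) {v : U} (h : 0 < t.dep v) : v ≠ t.root := by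
  rintro rfl
  rw [t.dep_root] at h
  omega

lemma RT.eq_root_of_dep (t : RT U) {v : U} (h : t.dep v = 0) : v = t.root := by
  by_contra hv
  have := t.dep_par v hv
  omega

lemma RT.desc_card (t : RT U) {Δ : ℕ} (hΔ : ∀ v, (t.ch v).card ≤ Δ) (j : ℕ) (u : U) :
    (univ.filter (fun v => j ≤ t.dep v ∧ t.par^[j] v = u)).card ≤ Δ ^ j := by
  induction j with
  | zero =>
    have : (univ.filter (fun v => 0 ≤ t.dep v ∧ t.par^[0] v = u)) = {u} := by
      ext x; simp
    rw [this]; simp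
  | succ j ih =>
    have hsub : (univ.filter (fun v => j + 1 ≤ t.dep v ∧ t.par^[j + 1] v = u)) ⊆
        (univ.filter (fun v => j ≤ t.dep v ∧ t.par^[j] v = u)).biUnion t.ch := by
      intro v hv
      simp only [mem_filter, mem_univ, true_and] at hv
      rw [mem_biUnion]
      refine ⟨t.par v, ?_, RT.mem_ch.2 ⟨t.ne_root_of_dep (by omega), rfl⟩⟩
      simp only [mem_filter, mem_univ, true_and, t.dep_par']
      exact ⟨by omega, by rw [← Function.iterate_succ_apply]; exact hv.2⟩
    refine (card_le_card hsub).trans ((card_biUnion_le_card_mul _ _ Δ (fun v _ => hΔ v)).trans ?_)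
    rw [pow_succ]
    exact Nat.mul_le_mul_right _ ih

lemma RT.shallow_card (t : RT U) {Δ : ℕ} (hΔ : ∀ v, (t.ch v).card ≤ Δ) (hΔ1 : 0 < Δ) (k : ℕ) :
    (univ.filter (fun v => t.dep v < k)).card ≤ k * Δ ^ k := by
  have hsub : (univ.filter (fun v => t.dep v < k)) ⊆
      (range k).biUnion (fun j => univ.filter (fun v => j ≤ t.dep v ∧ t.par^[j] v = t.root)) := by
    intro v hv
    simp only [mem_filter, mem_univ, true_and] at hv
    rw [mem_biUnion]
    refine ⟨t.dep v, mem_range.2 hv, ?_⟩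
    simp only [mem_filter, mem_univ, true_and]
    exact ⟨le_rfl, t.eq_root_of_dep (by rw [t.dep_iter]; omega)⟩
  refine (card_le_card hsub).trans ((card_biUnion_le_card_mul _ _ (Δ ^ k) ?_).trans (by simp))
  intro j hj
  exact (t.desc_card hΔ j _).trans (Nat.pow_le_pow_right hΔ1 (mem_range.1 hj).le)

/-- greedy selection of a conflict-free subfamily -/
lemma greedy_select {X : Type*} (r : X → X → Prop) (hr : ∀ x, r x x) (hs : ∀ x y, r x y → r y x)
    (b : ℕ) (n : ℕ) : ∀ S : Finset X, S.card = n →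
    (∀ x ∈ S, (S.filter (fun y => r x y)).card ≤ b) →
    ∃ Y ⊆ S, (∀ x ∈ Y, ∀ y ∈ Y, r x y → x = y) ∧ S.card ≤ b * Y.card := by
  induction n using Nat.strong_induction_on with
  | _ n ih =>
    intro S hS hb
    by_cases hne : S = ∅
    · exact ⟨∅, by simp, by simp, by simp [hne]⟩
    obtain ⟨x, hx⟩ := nonempty_iff_ne_empty.2 hne
    set S' := S.filter (fun y => ¬ r x y) with hS'
    have hcard : (S.filter (fun y => r x y)).card + S'.card = S.card :=
      card_filter_add_card_filter_not _
    have hpos : 0 < (S.filter (fun y => r x y)).card :=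
      card_pos.2 ⟨x, mem_filter.2 ⟨hx, hr x⟩⟩
    obtain ⟨Y, hYS, hY, hYc⟩ := ih S'.card (by omega) S' rfl (fun y hy =>
      (card_le_card (filter_subset_filter _ (filter_subset _ _))).trans (hb y (mem_filter.1 hy).1))
    have hxY : x ∉ Y := fun h => (mem_filter.1 (hYS h)).2 (hr x)
    refine ⟨insert x Y, ?_, ?_, ?_⟩
    · exact insert_subset hx (hYS.trans (filter_subset _ _))
    · intro a ha c hc hac
      rcases mem_insert.1 ha with h1 | h1 <;> rcases mem_insert.1 hc with h2 | h2
      · rw [h1, h2]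
      · rw [h1] at hac
        exact absurd hac (mem_filter.1 (hYS h2)).2
      · rw [h2] at hac
        exact absurd (hs _ _ hac) (mem_filter.1 (hYS h1)).2
      · exact hY a h1 c h2 hac
    · rw [card_insert_of_notMem hxY]
      have := hb x hx
      nlinarith

/-- choose vertices whose upward chains of length `k` are pairwise disjoint -/
lemma RT.chains (t : RT U) {Δ : ℕ} (hΔ : ∀ v, (t.ch v).card ≤ Δ) (hΔ1 : 0 < Δ) (k : ℕ) (hk : 0 < k)
    (S : Finset U) (hS : ∀ v ∈ S, k ≤ t.dep v) :
    ∃ Y ⊆ S, (∀ x ∈ Y, ∀ y ∈ Y, ∀ i < k, ∀ j < k, t.par^[i] x = t.par^[j] y → x = y) ∧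
      S.card ≤ (k * (k * Δ ^ k)) * Y.card := by
  obtain ⟨Y, hY, h1, h2⟩ := greedy_select
    (fun x y : U => ∃ i < k, ∃ j < k, t.par^[i] x = t.par^[j] y)
    (fun x => ⟨0, hk, 0, hk, rfl⟩) (fun x y ⟨i, hi, j, hj, h⟩ => ⟨j, hj, i, hi, h.symm⟩)
    (k * (k * Δ ^ k)) _ S rfl (by
      intro x hx
      refine le_trans (card_le_card (t := (range k).biUnion (fun i => (range k).biUnion (fun j =>
            univ.filter (fun v => j ≤ t.dep v ∧ t.par^[j] v = t.par^[i] x)))) ?_)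
        (le_trans (b := (range k).card * (k * Δ ^ k))
        (card_biUnion_le_card_mul _ _ (k * Δ ^ k) ?_) (by rw [card_range]))
      · intro y hy
        simp only [mem_filter] at hy
        obtain ⟨hyS, i, hi, j, hj, hij⟩ := hy
        have := hS y hyS
        simp only [mem_biUnion, mem_range, mem_filter, mem_univ, true_and]
        exact ⟨i, hi, j, hj, by omega, hij.symm⟩
      intro i _
      refine (card_biUnion_le_card_mul _ _ (Δ ^ k) ?_).trans (by simp)
      intro j hj
      exact (t.desc_card hΔ j _).trans (Nat.pow_le_pow_right hΔ1 (mem_range.1 hj).le))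
  exact ⟨Y, hY, fun x hx y hy i hi j hj h => h1 x hx y hy ⟨i, hi, j, hj, h⟩, h2⟩

/-- the cut vertices outside of `E` -/
noncomputable def RT.cuts (t : RT U) (E : Finset U) (h r : ℕ) : Finset U :=
  univ.filter (fun v => v ∉ E ∧ (v = t.root ∨ t.dep v % h = r ∨ t.par v ∈ E))

lemma RT.reach (t : RT U) (E : Finset U) (h r : ℕ) (j : ℕ) : ∀ v, v ∉ E →
    t.dep v % h = (r + j) % h → r < h → ∃ i ≤ j, t.par^[i] v ∈ t.cuts E h r := by
  induction j with
  | zero =>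
    intro v hv hd hr
    refine ⟨0, le_rfl, ?_⟩
    simp only [RT.cuts, mem_filter, mem_univ, true_and, Function.iterate_zero, id]
    rw [add_zero, Nat.mod_eq_of_lt hr] at hd
    exact ⟨hv, Or.inr (Or.inl hd)⟩
  | succ j ih =>
    intro v hv hd hr
    by_cases hc : v ∈ t.cuts E h r
    · exact ⟨0, Nat.zero_le _, hc⟩
    · simp only [RT.cuts, mem_filter, mem_univ, true_and, not_and, not_or] at hc
      obtain ⟨hvr, _, hpE⟩ := hc hv
      have hdp := t.dep_par v hvr
      obtain ⟨i, hi, h2⟩ := ih (t.par v) hpE (by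
        have : (t.dep (t.par v) + 1) ≡ (r + j) + 1 [MOD h] := by
          rw [hdp]; exact hd
        exact Nat.ModEq.add_right_cancel' 1 this) hr
      exact ⟨i + 1, by omega, by rw [Function.iterate_succ_apply]; exact h2⟩

lemma RT.blocks (t : RT U) {Δ : ℕ} (hΔ : ∀ v, (t.ch v).card ≤ Δ) (hΔ1 : 0 < Δ)
    (E : Finset U) (h r : ℕ) (hr : r < h) :
    ∃ blk : U → Finset U,
      (∀ c ∈ t.cuts E h r, Disjoint (blk c) E) ∧
      (∀ c ∈ t.cuts E h r, ∀ c' ∈ t.cuts E h r, c ≠ c' → Disjoint (blk c) (blk c')) ∧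
      (∀ c ∈ t.cuts E h r, c ∈ blk c ∧
        ∀ v ∈ blk c, t.dep c ≤ t.dep v ∧ (v ≠ c → t.par v ∈ blk c ∧ v ≠ t.root)) ∧
      (∀ c ∈ t.cuts E h r, (blk c).card ≤ h * Δ ^ h) ∧
      (t.cuts E h r).biUnion blk = univ \ E := by
  set C := t.cuts E h r with hC
  have hCE : ∀ v ∈ C, v ∉ E := fun v hv => (mem_filter.1 hv).2.1
  have hex : ∀ v, v ∉ E → ∃ i < h, t.par^[i] v ∈ C := by
    intro v hv
    have hlt := Nat.mod_lt (t.dep v + (h - r)) (show 0 < h by omega)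
    obtain ⟨i, hi, h2⟩ := t.reach E h r ((t.dep v + (h - r)) % h) v hv (by
      rw [Nat.add_mod_mod]
      have : r + (t.dep v + (h - r)) = t.dep v + h := by omega
      rw [this, Nat.add_mod_right]) hr
    exact ⟨i, by omega, h2⟩
  -- relation: c is the first cut vertex above v
  let Rel : U → U → Prop := fun v c => ∃ i < h, t.par^[i] v = c ∧ c ∈ C ∧ ∀ j < i, t.par^[j] v ∉ E ∧ t.par^[j] v ∉ C
  have hrel : ∀ v, v ∉ E → ∃ c, Rel v c := by
    intro v hv
    have hex' : ∃ i, t.par^[i] v ∈ C := by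
      obtain ⟨i, -, h2⟩ := hex v hv; exact ⟨i, h2⟩
    have hlt : Nat.find hex' < h := by
      obtain ⟨i, hi, h2⟩ := hex v hv
      exact (Nat.find_min' hex' h2).trans_lt hi
    refine ⟨_, Nat.find hex', hlt, rfl, Nat.find_spec hex', ?_⟩
    have hnc : ∀ j < Nat.find hex', t.par^[j] v ∉ C := fun j hj => Nat.find_min hex' hj
    intro j hj
    refine ⟨?_, hnc j hj⟩
    induction j with
    | zero => exact hv
    | succ j ihj =>
      have h1 := ihj (by omega)
      have h2 := hnc j (by omega)
      simp only [hC, RT.cuts, mem_filter, mem_univ, true_and, not_and, not_or] at h2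
      rw [Function.iterate_succ_apply']
      exact (h2 h1).2.2
  have huniq : ∀ v c c', Rel v c → Rel v c' → c = c' := by
    rintro v c c' ⟨i, -, hi, hcC, hmin⟩ ⟨i', -, hi', hcC', hmin'⟩
    rcases lt_trichotomy i i' with hlt | rfl | hlt
    · exact absurd (hi ▸ hcC) (hmin' i hlt).2
    · rw [← hi, ← hi']
    · exact absurd (hi' ▸ hcC') (hmin i' hlt).2
  refine ⟨fun c => univ.filter (fun v => v ∉ E ∧ Rel v c), ?_, ?_, ?_, ?_, ?_⟩
  · intro c _
    rw [disjoint_left]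
    intro v hv
    exact (mem_filter.1 hv).2.1
  · intro c _ c' _ hcc
    rw [disjoint_left]
    intro v hv hv'
    exact hcc (huniq v c c' (mem_filter.1 hv).2.2 (mem_filter.1 hv').2.2)
  · intro c hc
    constructor
    · exact mem_filter.2 ⟨mem_univ _, hCE c hc, 0, by omega, rfl, hc, fun j hj => by omega⟩
    · intro v hv
      obtain ⟨-, hvE, i, hi, hic, -, hmin⟩ := mem_filter.1 hv
      constructor
      · rw [← hic, t.dep_iter]; omega
      · intro hvc
        have hi0 : i ≠ 0 := by rintro rfl; exact hvc hic
        obtain ⟨i, rfl⟩ := Nat.exists_eq_succ_of_ne_zero hi0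
        have h0 := hmin 0 (by omega)
        have h3 := h0.2
        simp only [hC, RT.cuts, mem_filter, mem_univ, true_and, not_and, not_or,
          Function.iterate_zero, id] at h3
        obtain ⟨h4, -, h5⟩ := h3 hvE
        refine ⟨mem_filter.2 ⟨mem_univ _, h5, i, by omega, ?_, hc, ?_⟩, h4⟩
        · rw [← hic, Function.iterate_succ_apply]
        · intro j hj
          rw [← Function.iterate_succ_apply]
          exact hmin (j + 1) (by omega)
  · intro c hc
    have hsub : (univ.filter (fun v => v ∉ E ∧ Rel v c)) ⊆
        (range h).biUnion (fun j => univ.filter (fun v => j ≤ t.dep v ∧ t.par^[j] v = c)) := by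
      intro v hv
      obtain ⟨-, hvE, i, hi, hic, -, hmin⟩ := mem_filter.1 hv
      simp only [mem_biUnion, mem_range, mem_filter, mem_univ, true_and]
      refine ⟨i, hi, ?_, hic⟩
      by_contra hlt
      push Not at hlt
      have h1 := hmin (t.dep v) hlt
      have h2 : t.par^[t.dep v] v = t.root := t.eq_root_of_dep (by rw [t.dep_iter]; omega)
      rw [h2] at h1
      exact h1.2 (mem_filter.2 ⟨mem_univ _, h1.1, Or.inl rfl⟩)
    refine (card_le_card hsub).trans ((card_biUnion_le_card_mul _ _ (Δ ^ h) ?_).trans (by simp))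
    intro j hj
    exact (t.desc_card hΔ j _).trans (Nat.pow_le_pow_right hΔ1 (mem_range.1 hj).le)
  · ext v
    simp only [mem_biUnion, mem_filter, mem_univ, true_and, mem_sdiff]
    constructor
    · rintro ⟨c, -, h1, -⟩; exact h1
    · intro hv
      obtain ⟨c, hc⟩ := hrel v hv
      obtain ⟨i, hi, h1, h2, h3⟩ := hc
      exact ⟨c, h2, hv, i, hi, h1, h2, h3⟩

/-- number of cuts for a good residue -/
lemma RT.cuts_card (t : RT U) (E : Finset U) (h : ℕ) (hh : 0 < h) :
    ∃ r < h, (t.cuts E h r).card ≤ 1 + Fintype.card U / h +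
      (univ.filter (fun v => v ∉ E ∧ v ≠ t.root ∧ t.par v ∈ E)).card := by
  obtain ⟨r, hr, hrc⟩ : ∃ r ∈ range h,
      ((univ : Finset U).filter (fun v => t.dep v % h = r)).card < Fintype.card U / h + 1 := by
    apply Finset.exists_card_fiber_lt_of_card_lt_mul (s := (univ : Finset U)) (t := range h)
      (f := fun v => t.dep v % h)
    rw [card_range, card_univ]
    exact Nat.lt_mul_div_succ _ hh
  refine ⟨r, mem_range.1 hr, ?_⟩
  have hsub : t.cuts E h r ⊆ ({t.root} ∪ (univ : Finset U).filter (fun v => t.dep v % h = r)) ∪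
      univ.filter (fun v => v ∉ E ∧ v ≠ t.root ∧ t.par v ∈ E) := by
    intro v hv
    simp only [RT.cuts, mem_filter, mem_univ, true_and] at hv
    simp only [mem_union, mem_filter, mem_univ, true_and, mem_singleton]
    by_cases h1 : v = t.root
    · exact Or.inl (Or.inl h1)
    · rcases hv.2 with h2 | h2 | h2
      · exact absurd h2 h1
      · exact Or.inl (Or.inr h2)
      · exact Or.inr ⟨hv.1, h1, h2⟩
  have h1 := card_le_card hsub
  have h2 := card_union_le ({t.root} ∪ (univ : Finset U).filter (fun v => t.dep v % h = r))
      (univ.filter (fun v => v ∉ E ∧ v ≠ t.root ∧ t.par v ∈ E))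
  have h3 := card_union_le {t.root} ((univ : Finset U).filter (fun v => t.dep v % h = r))
  rw [card_singleton] at h3
  omega

end ST

end

section
open Finset
open scoped Classical

set_option linter.unusedSectionVars false
namespace ST
variable {U V : Type*} [Fintype U] [Fintype V]

lemma exists_RT (T : SimpleGraph U) (hT : T.IsTree) : ∃ t : RT U,
    (∀ v, v ≠ t.root → T.Adj v (t.par v)) ∧
    ∀ u v, T.Adj u v → (u ≠ t.root ∧ t.par u = v) ∨ (v ≠ t.root ∧ t.par v = u) := by
  have hc := hT.1
  obtain ⟨r⟩ := hc.nonempty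
  have hpar : ∀ v, ∃ w, (v = r → w = r) ∧ (v ≠ r → T.Adj v w ∧ T.dist w r + 1 = T.dist v r) := by
    intro v
    by_cases hv : v = r
    · exact ⟨r, fun _ => rfl, fun h => absurd hv h⟩
    · obtain ⟨p, hp⟩ := hc.exists_walk_length_eq_dist v r
      cases p with
      | nil => exact absurd rfl hv
      | @cons _ w _ h q =>
        refine ⟨w, fun h => absurd h hv, fun _ => ⟨h, ?_⟩⟩
        have h1 := SimpleGraph.dist_le q
        rw [SimpleGraph.Walk.length_cons] at hp
        have h2 := hc.dist_triangle (u := v) (v := w) (w := r)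
        have h3 : T.dist v w = 1 := SimpleGraph.dist_eq_one_iff_adj.2 h
        omega
  choose par hp1 hp2 using hpar
  let t : RT U := 
    { root := r
      par := par
      dep := fun v => T.dist v r
      dep_par := fun v hv => (hp2 v hv).2
      dep_root := SimpleGraph.dist_self
      par_root := hp1 r rfl }
  have hadj : ∀ v, v ≠ t.root → T.Adj v (t.par v) := fun v hv => (hp2 v hv).1
  refine ⟨t, hadj, ?_⟩
  have hinj : Set.InjOn (fun v => s(v, t.par v)) ((univ.erase t.root : Finset U) : Set U) := by
    intro a ha b hb hab
    simp only [coe_erase, coe_univ, Set.mem_diff, Set.mem_univ, true_and, Set.mem_singleton_iff] at ha hb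
    simp only [Sym2.eq_iff] at hab
    rcases hab with h | h
    · exact h.1
    · have h1 := t.dep_par a ha
      have h2 := t.dep_par b hb
      rw [h.2] at h1
      rw [← h.1] at h2
      omega
  have hE := hT.card_edgeFinset
  have himg : (univ.erase t.root).image (fun v => s(v, t.par v)) = T.edgeFinset := by
    apply eq_of_subset_of_card_le
    · intro e he
      obtain ⟨v, hv, rfl⟩ := mem_image.1 he
      rw [SimpleGraph.mem_edgeFinset, SimpleGraph.mem_edgeSet]
      exact hadj v (ne_of_mem_erase hv)
    · rw [card_image_of_injOn hinj, card_erase_of_mem (mem_univ _), card_univ]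
      omega
  intro u v huv
  have : s(u, v) ∈ T.edgeFinset := by
    rw [SimpleGraph.mem_edgeFinset, SimpleGraph.mem_edgeSet]; exact huv
  rw [← himg] at this
  obtain ⟨w, hw, hwe⟩ := mem_image.1 this
  have hw' := ne_of_mem_erase hw
  simp only [Sym2.eq_iff] at hwe
  rcases hwe with h | h
  · left; rw [← h.1, ← h.2]; exact ⟨hw', rfl⟩
  · right; rw [← h.1, ← h.2]; exact ⟨hw', rfl⟩

lemma RT.sum_ch (t : RT U) : ∑ v, (t.ch v).card + 1 = Fintype.card U := by
  have h := card_eq_sum_card_fiberwise (s := univ.erase t.root) (t := (univ : Finset U)) (f := t.par)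
    (fun _ _ => by simp)
  rw [card_erase_of_mem (mem_univ _), card_univ] at h
  have hpos : 0 < Fintype.card U := Fintype.card_pos_iff.2 ⟨t.root⟩
  have : ∑ v, (t.ch v).card = ∑ b, ((univ.erase t.root).filter (fun a => t.par a = b)).card := by
    apply sum_congr rfl
    intro v _
    congr 1
    ext u
    simp [RT.ch]
  omega

/-- leaves -/
noncomputable def RT.leaves (t : RT U) : Finset U := univ.filter (fun v => (t.ch v).card = 0)
noncomputable def RT.bad (t : RT U) : Finset U := univ.filter (fun v => (t.ch v).card ≠ 1)

lemma RT.bad_card (t : RT U) : t.bad.card ≤ 2 * t.leaves.card := by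
  have h1 := t.sum_ch
  have h2 : ∑ v : U, 1 + t.bad.card ≤ ∑ v, (t.ch v).card + 2 * t.leaves.card := by
    rw [RT.bad, RT.leaves, card_filter, card_filter, mul_sum, ← sum_add_distrib, ← sum_add_distrib]
    apply sum_le_sum
    intro v _
    split_ifs <;> omega
  rw [sum_const, card_univ, smul_eq_mul, mul_one] at h2
  omega

end ST

end

section
open Finset
open scoped Classical

set_option linter.unusedSectionVars false
namespace ST
variable {U V : Type*} [Fintype U] [Fintype V]

lemma pow_quarter (b : ℕ) (hb : 0 < b) : (1 - 1 / (2 * (b : ℝ))) ^ (6 * b) ≤ 1 / 4 := by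
  have hb' : (1 : ℝ) ≤ b := by exact_mod_cast hb
  set x : ℝ := 1 / (2 * (b : ℝ)) with hx
  have hx0 : 0 < x := by positivity
  have hx1 : x ≤ 1 := by
    rw [hx, div_le_one (by positivity)]; linarith
  have h1 : 1 + ((6 * b : ℕ) : ℝ) * x ≤ (1 + x) ^ (6 * b) :=
    one_add_mul_le_pow (by linarith) _
  have h2 : ((6 * b : ℕ) : ℝ) * x = 3 := by
    rw [hx]; push_cast; field_simp; norm_num
  have h3 : (1 - x) ^ (6 * b) * (1 + x) ^ (6 * b) ≤ 1 := by
    rw [← mul_pow]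
    apply pow_le_one₀ <;> nlinarith
  have h4 : 0 ≤ (1 - x) ^ (6 * b) := pow_nonneg (by linarith) _
  nlinarith

/-- derandomised selection -/
lemma steer {J X I L : Type*} [Fintype I] [Nonempty X] (cp : X → X → Prop)
    (hcp : ∀ x y, cp x y → cp y x) (single : X → Prop)
    (Good : I → X → Prop) (b N : ℕ) (hb : 0 < b) (Y : Finset L)
    (hstep : ∀ (Y' : Finset L) (τ : L → X), Y'.card < Y.card → (∀ y ∈ Y', single (τ y)) →
      ∃ (Ω : Finset J) (g : J → X), Ω.Nonempty ∧ (∀ ω ∈ Ω, single (g ω)) ∧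
        (∀ ω ∈ Ω, ∀ y ∈ Y', cp (g ω) (τ y)) ∧
        ∀ i, Ω.card ≤ b * (Ω.filter (fun ω => Good i (g ω))).card)
    (hY : 6 * b * N ≤ Y.card) (hI : Fintype.card I ≤ 2 ^ N) :
    ∃ τ : L → X, (∀ y ∈ Y, single (τ y)) ∧ (∀ y ∈ Y, ∀ y' ∈ Y, y ≠ y' → cp (τ y) (τ y')) ∧
      ∀ i, N ≤ (Y.filter (fun y => Good i (τ y))).card := by
  set q : ℝ := 1 - 1 / (2 * (b : ℝ)) with hq
  have hb' : (1 : ℝ) ≤ b := by exact_mod_cast hb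
  have hq0 : 0 ≤ q := by
    rw [hq, sub_nonneg, div_le_one (by positivity)]; linarith
  have hq1 : q ≤ 1 := by
    rw [hq]; have : 0 ≤ 1 / (2 * (b : ℝ)) := by positivity
    linarith
  have main : ∀ Y' : Finset L, Y' ⊆ Y → ∃ τ : L → X, (∀ y ∈ Y', single (τ y)) ∧
      (∀ y ∈ Y', ∀ y' ∈ Y', y ≠ y' → cp (τ y) (τ y')) ∧
      ∑ i, (1 / 2 : ℝ) ^ (Y'.filter (fun y => Good i (τ y))).card ≤
        Fintype.card I * q ^ Y'.card := by
    intro Y'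
    induction Y' using Finset.induction_on with
    | empty => 
      intro _
      exact ⟨fun _ => Classical.arbitrary X, by simp, by simp, by simp⟩
    | insert y Y' hy ih =>
      intro hsub
      obtain ⟨τ, h1, h2, h3⟩ := ih ((subset_insert _ _).trans hsub)
      have hlt : Y'.card < Y.card := by
        have := card_le_card hsub
        rw [card_insert_of_notMem hy] at this
        omega
      obtain ⟨Ω, g, hΩ, g1, g2, g3⟩ := hstep Y' τ hlt h1
      set w : I → ℝ := fun i => (1 / 2 : ℝ) ^ (Y'.filter (fun y => Good i (τ y))).card with hw
      have hw0 : ∀ i, 0 ≤ w i := fun i => by positivity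
      have hsum : ∑ ω ∈ Ω, ∑ i, w i * (if Good i (g ω) then (1/2 : ℝ) else 1) ≤
          ∑ ω ∈ Ω, q * ∑ i, w i := by
        rw [sum_comm, sum_const, nsmul_eq_mul, mul_sum, mul_sum]
        apply sum_le_sum
        intro i _
        rw [← mul_sum]
        have h5 : ∑ ω ∈ Ω, (if Good i (g ω) then (1/2 : ℝ) else 1) =
            Ω.card - (1/2) * (Ω.filter (fun ω => Good i (g ω))).card := by
          have : ∀ ω ∈ Ω, (if Good i (g ω) then (1/2 : ℝ) else 1) =
              1 - (1/2) * (if Good i (g ω) then (1 : ℝ) else 0) := by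
            intro ω _; split_ifs <;> norm_num
          rw [sum_congr rfl this, sum_sub_distrib, ← mul_sum, sum_boole]
          simp
        rw [h5]
        have h6 : (Ω.card : ℝ) ≤ b * (Ω.filter (fun ω => Good i (g ω))).card := by
          exact_mod_cast g3 i
        have h7 : (Ω.card : ℝ) / b ≤ (Ω.filter (fun ω => Good i (g ω))).card := by
          rw [div_le_iff₀ (by linarith)]; linarith
        have h8 : (Ω.card : ℝ) - (1/2) * (Ω.filter (fun ω => Good i (g ω))).card ≤ Ω.card * q := by
          have : (Ω.card : ℝ) * q = Ω.card - (1/2) * (Ω.card / b) := by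
            rw [hq]; field_simp
          rw [this]; linarith
        calc _ ≤ w i * (Ω.card * q) := mul_le_mul_of_nonneg_left h8 (hw0 i)
          _ = _ := by ring
      obtain ⟨ω, hω, hle⟩ := exists_le_of_sum_le hΩ hsum
      have hne : ∀ z ∈ Y', z ≠ y := fun z hz h => hy (h ▸ hz)
      refine ⟨Function.update τ y (g ω), ?_, ?_, ?_⟩
      · intro z hz
        rcases mem_insert.1 hz with rfl | hz
        · simpa using g1 ω hω
        · rw [Function.update_of_ne (hne z hz)]; exact h1 z hz
      · intro z hz z' hz' hzz
        rcases mem_insert.1 hz with h | h <;> rcases mem_insert.1 hz' with h' | h'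
        · exact absurd (h.trans h'.symm) hzz
        · rw [h, Function.update_self, Function.update_of_ne (hne z' h')]
          exact g2 ω hω z' h'
        · rw [h', Function.update_self, Function.update_of_ne (hne z h)]
          exact hcp _ _ (g2 ω hω z h)
        · rw [Function.update_of_ne (hne z h), Function.update_of_ne (hne z' h')]
          exact h2 z h z' h' hzz
      · have h9 : ∀ i, (1 / 2 : ℝ) ^ ((insert y Y').filter
            (fun z => Good i (Function.update τ y (g ω) z))).card =
            w i * (if Good i (g ω) then (1/2 : ℝ) else 1) := by
          intro i
          have hf : Y'.filter (fun z => Good i (Function.update τ y (g ω) z)) =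
              Y'.filter (fun z => Good i (τ z)) := by
            apply filter_congr
            intro z hz
            rw [Function.update_of_ne (hne z hz)]
          rw [filter_insert, Function.update_self, hf]
          split_ifs with hG
          · rw [card_insert_of_notMem (fun h => hy (mem_filter.1 h).1), pow_succ]
          · rw [mul_one]
        rw [sum_congr rfl (fun i _ => h9 i), card_insert_of_notMem hy, pow_succ]
        calc _ ≤ q * ∑ i, w i := hle
          _ ≤ q * (Fintype.card I * q ^ Y'.card) := mul_le_mul_of_nonneg_left h3 hq0
          _ = _ := by ring
  obtain ⟨τ, h1, h2, h3⟩ := main Y subset_rfl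
  refine ⟨τ, h1, h2, ?_⟩
  intro i
  by_contra hlt
  push Not at hlt
  set c := (Y.filter (fun y => Good i (τ y))).card with hc
  have h4 : (1 / 2 : ℝ) ^ c ≤ ∑ i, (1 / 2 : ℝ) ^ (Y.filter (fun y => Good i (τ y))).card :=
    single_le_sum (f := fun i => (1 / 2 : ℝ) ^ (Y.filter (fun y => Good i (τ y))).card)
      (fun i _ => by positivity) (mem_univ i)
  have h5 : q ^ Y.card ≤ (1 / 4) ^ N := by
    calc q ^ Y.card ≤ q ^ (6 * b * N) := pow_le_pow_of_le_one hq0 hq1 hY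
      _ = (q ^ (6 * b)) ^ N := by rw [pow_mul]
      _ ≤ (1 / 4) ^ N := pow_le_pow_left₀ (pow_nonneg hq0 _) (pow_quarter b hb) _
  have h6 : (Fintype.card I : ℝ) ≤ 2 ^ N := by exact_mod_cast hI
  have h7 : (Fintype.card I : ℝ) * q ^ Y.card ≤ 2 ^ N * (1 / 4) ^ N :=
    mul_le_mul h6 h5 (pow_nonneg hq0 _) (by positivity)
  rw [← mul_pow] at h7
  norm_num at h7
  have h8 : (1 / 2 : ℝ) ^ N < (1 / 2) ^ c :=
    pow_lt_pow_right_of_lt_one₀ (by norm_num) (by norm_num) hlt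
  norm_num at h8 h4 h3
  linarith

end ST

end

section
open Finset
open scoped Classical

set_option linter.unusedSectionVars false
namespace ST
variable {U V : Type*} [Fintype U] [Fintype V]

lemma floats {L : Type*} [Nonempty V] (G : SimpleGraph V) (d e N : ℕ) (hd : ∀ v, d ≤ (nb G v).card)
    (he : Fintype.card V ≤ e * d) (F : Finset V) (Y : Finset L) (hF : 2 * (F.card + Y.card) ≤ d)
    (hY : 12 * e * N ≤ Y.card) (hI : Fintype.card V ≤ 2 ^ N) :
    ∃ τ : L → V, (∀ y ∈ Y, τ y ∉ F) ∧ (∀ y ∈ Y, ∀ y' ∈ Y, y ≠ y' → τ y ≠ τ y') ∧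
      ∀ v, N ≤ (Y.filter (fun y => G.Adj v (τ y))).card := by
  have hn : 0 < Fintype.card V := Fintype.card_pos
  have he0 : 0 < e := by
    rcases Nat.eq_zero_or_pos e with h | h
    · subst h; omega
    · exact h
  have hd0 : 0 < d := by
    rcases Nat.eq_zero_or_pos d with h | h
    · subst h; omega
    · exact h
  apply steer (J := V) (fun x y : V => x ≠ y) (fun x y h => h.symm) (fun x => x ∉ F)
    (fun v x => G.Adj v x) (2 * e) N (by omega) Y _ (by nlinarith) hI
  intro Y' τ hY' _
  have hgood : ∀ v, d ≤ 2 * ((univ \ (F ∪ Y'.image τ)).filter (fun ω => G.Adj v ω)).card := by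
    intro v
    have h1 : (univ \ (F ∪ Y'.image τ)).filter (fun ω => G.Adj v ω) = nb G v \ (F ∪ Y'.image τ) := by
      ext x; simp only [mem_filter, mem_sdiff, mem_univ, true_and, mem_nb]; exact and_comm
    rw [h1]
    have h2 := le_card_sdiff (F ∪ Y'.image τ) (nb G v)
    have h3 := card_union_le F (Y'.image τ)
    have h4 : (Y'.image τ).card ≤ Y'.card := card_image_le
    have := hd v
    omega
  refine ⟨univ \ (F ∪ Y'.image τ), id, ?_, ?_, ?_, ?_⟩
  · have h1 := hgood (Classical.arbitrary V)
    have h2 : 0 < ((univ \ (F ∪ Y'.image τ)).filter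
      (fun ω => G.Adj (Classical.arbitrary V) ω)).card := by omega
    obtain ⟨x, hx⟩ := card_pos.1 h2
    exact ⟨x, (mem_filter.1 hx).1⟩
  · intro ω hω h
    exact (mem_sdiff.1 hω).2 (mem_union_left _ h)
  · intro ω hω y hy h
    exact (mem_sdiff.1 hω).2 (mem_union_right _ (mem_image.2 ⟨y, hy, h.symm⟩))
  · intro v
    have h1 := hgood v
    have h2 : (univ \ (F ∪ Y'.image τ)).card ≤ Fintype.card V := card_le_univ _
    calc _ ≤ e * d := h2.trans he
      _ ≤ e * (2 * ((univ \ (F ∪ Y'.image τ)).filter (fun ω => G.Adj v ω)).card) :=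
        Nat.mul_le_mul_left _ h1
      _ = _ := by simp only [id]; ring

lemma reserve [Nonempty V] (G : SimpleGraph V) (d e N r : ℕ) (hd : ∀ v, d ≤ (nb G v).card)
    (he : Fintype.card V ≤ e * d) (F : Finset V) (hF : 2 * (F.card + r) ≤ d)
    (hY : 12 * e * N ≤ r) (hI : Fintype.card V ≤ 2 ^ N) :
    ∃ R : Finset V, R.card = r ∧ Disjoint R F ∧ ∀ v, N ≤ (nb G v ∩ R).card := by
  obtain ⟨τ, h1, h2, h3⟩ := floats (L := Fin r) G d e N hd he F univ (by simpa using hF)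
    (by simpa using hY) hI
  have hinj : Function.Injective τ := by
    intro a b hab
    by_contra hne
    exact h2 a (mem_univ _) b (mem_univ _) hne hab
  refine ⟨univ.image τ, ?_, ?_, ?_⟩
  · rw [card_image_of_injective _ hinj]; simp
  · rw [disjoint_left]
    intro x hx
    obtain ⟨y, hy, rfl⟩ := mem_image.1 hx
    exact h1 y hy
  · intro v
    refine (h3 v).trans ?_
    rw [← card_image_of_injective _ hinj]
    apply card_le_card
    intro x hx
    obtain ⟨y, hy, rfl⟩ := mem_image.1 hx
    exact mem_inter.2 ⟨mem_nb.2 (mem_filter.1 hy).2, mem_image_of_mem _ (mem_univ _)⟩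

/-- an absorbing gadget -/
structure IsGad (G : SimpleGraph V) (τ : ℕ → V) : Prop where
  inj : ∀ i < 11, ∀ j < 11, τ i = τ j → i = j
  path : ∀ i < 10, G.Adj (τ i) (τ (i + 1))
  a20 : G.Adj (τ 2) (τ 0)
  a95 : G.Adj (τ 9) (τ 5)

/-- the gadget can absorb `w` while releasing a neighbour of `x` -/
def GoodG (G : SimpleGraph V) (w x : V) (τ : ℕ → V) : Prop :=
  G.Adj w (τ 10) ∧ G.Adj w (τ 6) ∧ G.Adj x (τ 1)

lemma gad_exists (G : SimpleGraph V) (s d : ℕ) (hJ : Joined G s) (hd : ∀ v, d ≤ (nb G v).card)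
    (F : Finset V) (hF : F.card + 11 + 2 * s ≤ d) (p1 p2 z : V) (h1 : p1 ∉ F) (h2 : p2 ∉ F)
    (h3 : z ∉ F) (h12 : p1 ≠ p2) (h13 : p1 ≠ z) (h23 : p2 ≠ z) :
    ∃ τ : ℕ → V, IsGad G τ ∧ (∀ i < 11, τ i ∉ F) ∧ τ 10 = p1 ∧ τ 6 = p2 ∧ τ 1 = z := by
  have key : ∀ (l : List V) (x y : V), l.length ≤ 11 → ∃ a b, a ∉ F ∧ b ∉ F ∧ a ∉ l ∧ b ∉ l ∧
      a ≠ b ∧ G.Adj x a ∧ G.Adj a b ∧ G.Adj b y := by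
    intro l x y hl
    have hc : (F ∪ l.toFinset).card ≤ F.card + 11 := by
      have := card_union_le F l.toFinset
      have := l.toFinset_card_le
      omega
    obtain ⟨a, b, -, -, ha, hb, h4, h5, h6⟩ := connect hJ univ (F ∪ l.toFinset) x y
      (by rw [inter_univ]; have := hd x; omega) (by rw [inter_univ]; have := hd y; omega)
    simp only [mem_union, List.mem_toFinset, not_or] at ha hb
    exact ⟨a, b, ha.1, hb.1, ha.2, hb.2, h5.ne, h4, h5, h6⟩
  obtain ⟨a, b, haF, hbF, ha, hb, hab, A1, A2, A3⟩ := key [p1, p2, z] p1 p2 (by simp)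
  obtain ⟨g, h, hgF, hhF, hg, hh, hgh, A4, A5, A6⟩ := key [p1, p2, z, a, b] p2 a (by simp)
  obtain ⟨p3, p4, hp3F, hp4F, hp3, hp4, hp34, A7, A8, A9⟩ := key [p1, p2, z, a, b, g, h] z z (by simp)
  obtain ⟨i, j, hiF, hjF, hi, hj, hij, A10, A11, A12⟩ :=
    key [p1, p2, z, a, b, g, h, p3, p4] b p3 (by simp)
  simp only [List.mem_cons, List.not_mem_nil, or_false, not_or] at ha hb hg hh hp3 hp4 hi hj
  have hnd : [p4, z, p3, j, i, b, p2, g, h, a, p1].Nodup := by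
    simp only [List.nodup_cons, List.mem_cons, List.not_mem_nil, or_false, not_or, not_false_eq_true,
      List.nodup_nil, and_true]
    refine ⟨⟨?_, ?_, ?_, ?_, ?_, ?_, ?_, ?_, ?_, ?_⟩, ⟨?_, ?_, ?_, ?_, ?_, ?_, ?_, ?_, ?_⟩,
      ⟨?_, ?_, ?_, ?_, ?_, ?_, ?_, ?_⟩, ⟨?_, ?_, ?_, ?_, ?_, ?_, ?_⟩, ⟨?_, ?_, ?_, ?_, ?_, ?_⟩,
      ⟨?_, ?_, ?_, ?_, ?_⟩, ⟨?_, ?_, ?_, ?_⟩, ⟨?_, ?_, ?_⟩, ⟨?_, ?_⟩, ?_⟩ <;>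
    grind
  refine ⟨fun k => [p4, z, p3, j, i, b, p2, g, h, a, p1].getD k p1, ⟨?_, ?_, ?_, ?_⟩, ?_, rfl, rfl, rfl⟩
  · intro x hx y hy hxy
    have hx' : x < [p4, z, p3, j, i, b, p2, g, h, a, p1].length := by simpa using hx
    have hy' : y < [p4, z, p3, j, i, b, p2, g, h, a, p1].length := by simpa using hy
    beta_reduce at hxy
    rw [List.getD_eq_getElem _ _ hx', List.getD_eq_getElem _ _ hy'] at hxy
    exact (hnd.getElem_inj_iff).1 hxy
  · intro x hx
    interval_cases x
    · exact A9
    · exact A7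
    · exact A12.symm
    · exact A11.symm
    · exact A10.symm
    · exact A3
    · exact A4
    · exact A5
    · exact A6
    · exact A1.symm
  · exact A8
  · exact A2
  · intro x hx
    interval_cases x <;> assumption

lemma gadgets {L : Type*} [Nonempty V] (G : SimpleGraph V) (s d d' e N : ℕ) (hJ : Joined G s)
    (hd : ∀ v, d ≤ (nb G v).card) (he : Fintype.card V ≤ e * d') (Y : Finset L)
    (h1 : 11 * Y.card + 11 + 2 * s ≤ d) (h2 : 11 * Y.card + 3 * d' ≤ d)
    (hY : 6 * e ^ 3 * N ≤ Y.card) (hI : Fintype.card V * Fintype.card V ≤ 2 ^ N) :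
    ∃ τ : L → ℕ → V, (∀ y ∈ Y, IsGad G (τ y)) ∧
      (∀ y ∈ Y, ∀ y' ∈ Y, y ≠ y' → ∀ i < 11, ∀ j < 11, τ y i ≠ τ y' j) ∧
      ∀ w x, N ≤ (Y.filter (fun y => GoodG G w x (τ y))).card := by
  have hn : 0 < Fintype.card V := Fintype.card_pos
  have he0 : 0 < e := by
    rcases Nat.eq_zero_or_pos e with h | h
    · subst h; omega
    · exact h
  have hd0 : 0 < d' := by
    rcases Nat.eq_zero_or_pos d' with h | h
    · subst h; omega
    · exact h
  obtain ⟨τ, g1, g2, g3⟩ := steer (J := V × V × V) (I := V × V) (X := ℕ → V)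
    (fun x y => ∀ i < 11, ∀ j < 11, x i ≠ y j)
    (fun x y h i hi j hj => (h j hj i hi).symm) (IsGad G)
    (fun wx τ => GoodG G wx.1 wx.2 τ)
    (e ^ 3) N (by positivity) Y (by
    intro Y' τ hY' _
    set F := Y'.biUnion (fun y => (range 11).image (τ y)) with hF
    have hFc : F.card ≤ 11 * Y'.card := by
      rw [mul_comm]
      refine card_biUnion_le_card_mul _ _ _ (fun y _ => ?_)
      exact card_image_le.trans (by simp)
    have hg : ∀ ω : V × V × V, ∃ τ' : ℕ → V, (ω.1 ∉ F ∧ ω.2.1 ∉ F ∧ ω.2.2 ∉ F ∧ ω.1 ≠ ω.2.1 ∧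
        ω.1 ≠ ω.2.2 ∧ ω.2.1 ≠ ω.2.2) → IsGad G τ' ∧ (∀ i < 11, τ' i ∉ F) ∧ τ' 10 = ω.1 ∧
        τ' 6 = ω.2.1 ∧ τ' 1 = ω.2.2 := by
      intro ω
      by_cases h : (ω.1 ∉ F ∧ ω.2.1 ∉ F ∧ ω.2.2 ∉ F ∧ ω.1 ≠ ω.2.1 ∧ ω.1 ≠ ω.2.2 ∧ ω.2.1 ≠ ω.2.2)
      · obtain ⟨k1, k2, k3, k4, k5, k6⟩ := h
        obtain ⟨τ', h'⟩ := gad_exists G s d hJ hd F (by omega) _ _ _ k1 k2 k3 k4 k5 k6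
        exact ⟨τ', fun _ => h'⟩
      · exact ⟨fun _ => Classical.arbitrary V, fun h' => absurd h' h⟩
    choose g hg using hg
    set Ω : Finset (V × V × V) := univ.filter (fun ω => ω.1 ∉ F ∧ ω.2.1 ∉ F ∧ ω.2.2 ∉ F ∧ ω.1 ≠ ω.2.1 ∧
        ω.1 ≠ ω.2.2 ∧ ω.2.1 ≠ ω.2.2) with hΩ
    have hgood : ∀ w x, d' ^ 3 ≤
        (Ω.filter (fun ω => GoodG G w x (g ω))).card := by
      intro w x
      obtain ⟨A3, hA3, hc3⟩ := exists_subset_card_eq (s := nb G x \ F) (n := d') (by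
        have := le_card_sdiff F (nb G x); have := hd x; omega)
      obtain ⟨A2, hA2, hc2⟩ := exists_subset_card_eq (s := (nb G w \ F) \ A3) (n := d') (by
        have := le_card_sdiff F (nb G w); have := le_card_sdiff A3 (nb G w \ F)
        have := hd w; omega)
      obtain ⟨A1, hA1, hc1⟩ := exists_subset_card_eq (s := ((nb G w \ F) \ A3) \ A2) (n := d') (by
        have := le_card_sdiff F (nb G w); have := le_card_sdiff A3 (nb G w \ F)
        have := le_card_sdiff A2 ((nb G w \ F) \ A3)
        have := hd w; omega)
      have : (A1 ×ˢ A2 ×ˢ A3).card = d' ^ 3 := by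
        rw [card_product, card_product, hc1, hc2, hc3]; ring
      rw [← this]
      apply card_le_card
      rintro ⟨u1, u2, u3⟩ hu
      simp only [mem_product] at hu
      obtain ⟨hu1, hu2, hu3⟩ := hu
      have k1 := hA1 hu1
      have k2 := hA2 hu2
      have k3 := hA3 hu3
      simp only [mem_sdiff, mem_nb] at k1 k2 k3
      have hv : ((u1, u2, u3) : V × V × V).1 ∉ F ∧ ((u1, u2, u3) : V × V × V).2.1 ∉ F ∧
          ((u1, u2, u3) : V × V × V).2.2 ∉ F ∧
          ((u1, u2, u3) : V × V × V).1 ≠ ((u1, u2, u3) : V × V × V).2.1 ∧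
          ((u1, u2, u3) : V × V × V).1 ≠ ((u1, u2, u3) : V × V × V).2.2 ∧
          ((u1, u2, u3) : V × V × V).2.1 ≠ ((u1, u2, u3) : V × V × V).2.2 :=
        ⟨k1.1.1.2, k2.1.2, k3.2, fun h => k1.2 (by simp only at h; rw [h]; exact hu2),
          fun h => k1.1.2 (by simp only at h; rw [h]; exact hu3),
          fun h => k2.2 (by simp only at h; rw [h]; exact hu3)⟩
      obtain ⟨-, -, e1, e2, e3⟩ := hg _ hv
      refine mem_filter.2 ⟨mem_filter.2 ⟨mem_univ _, hv⟩, ?_, ?_, ?_⟩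
      · rw [e1]; exact k1.1.1.1
      · rw [e2]; exact k2.1.1
      · rw [e3]; exact k3.1
    refine ⟨Ω, g, ?_, ?_, ?_, ?_⟩
    · have h1 := hgood (Classical.arbitrary V) (Classical.arbitrary V)
      have h3 : 0 < d' ^ 3 := by positivity
      obtain ⟨ω, hω⟩ := card_pos.1 (lt_of_lt_of_le h3 h1)
      exact ⟨ω, (mem_filter.1 hω).1⟩
    · intro ω hω
      exact (hg ω (mem_filter.1 hω).2).1
    · intro ω hω y hy i hi j hj h
      apply (hg ω (mem_filter.1 hω).2).2.1 i hi
      rw [h, hF]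
      exact mem_biUnion.2 ⟨y, hy, mem_image_of_mem _ (mem_range.2 hj)⟩
    · intro wx
      have hc : Ω.card ≤ Fintype.card V ^ 3 := by
        have := card_le_univ Ω
        rw [Fintype.card_prod, Fintype.card_prod] at this
        calc _ ≤ _ := this
          _ = _ := by ring
      calc Ω.card ≤ (e * d') ^ 3 := hc.trans (Nat.pow_le_pow_left he 3)
        _ = e ^ 3 * d' ^ 3 := by ring
        _ ≤ _ := Nat.mul_le_mul_left _ (hgood wx.1 wx.2)) hY (by
    rw [Fintype.card_prod]; exact hI)
  exact ⟨τ, g1, g2, fun w x => g3 (w, x)⟩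

end ST

end

section
open Finset
open scoped Classical

set_option linter.unusedSectionVars false
namespace ST
variable {U V : Type*} [Fintype U] [Fintype V]

lemma embed_mix (t : RT U) (G : SimpleGraph V) (s K dR : ℕ) (hJ : Joined G s) (R : Finset V)
    (hR : ∀ v, dR ≤ (nb G v ∩ R).card) (D0 : Finset U) (f0 : U → V) (h0 : Emb t G D0 f0)
    (hR0 : Disjoint R (D0.image f0)) (Lab : Finset U) (q c2 c1 : U → U)
    (hq : ∀ y ∈ Lab, q y ∈ D0 ∧ t.par (q y) = c2 y ∧ t.par (c2 y) = c1 y ∧ c2 y ≠ t.root ∧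
      c1 y ∉ D0 ∧ c2 y ∉ D0)
    (hi1 : ∀ y ∈ Lab, ∀ y' ∈ Lab, c1 y = c1 y' → y = y')
    (hi2 : ∀ y ∈ Lab, ∀ y' ∈ Lab, c2 y = c2 y' → y = y')
    (hi3 : ∀ y ∈ Lab, ∀ y' ∈ Lab, c1 y ≠ c2 y')
    (hu : ∀ v ∈ D0, v ≠ t.root → ∀ y ∈ Lab, (t.par v = c2 y → v = q y) ∧ t.par v ≠ c1 y)
    (blk0 : U → Finset U) (C0 : Finset U)
    (b1 : ∀ c ∈ C0, Disjoint (blk0 c) D0)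
    (b1' : ∀ c ∈ C0, ∀ y ∈ Lab, c1 y ∉ blk0 c ∧ c2 y ∉ blk0 c)
    (b2 : ∀ c ∈ C0, ∀ c' ∈ C0, c ≠ c' → Disjoint (blk0 c) (blk0 c'))
    (b3 : ∀ c ∈ C0, c ∈ blk0 c ∧
      ∀ v ∈ blk0 c, t.dep c ≤ t.dep v ∧ (v ≠ c → t.par v ∈ blk0 c ∧ v ≠ t.root))
    (b4 : ∀ c ∈ C0, (blk0 c).card ≤ K)
    (b5 : ∀ c ∈ C0, ∀ v ∈ D0, v ≠ t.root → t.par v ∉ blk0 c)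
    (hc5 : 2 * (C0.card + Lab.card) + 2 * s ≤ dR) (D : Finset U)
    (hD : D = D0 ∪ (Lab.image c1 ∪ Lab.image c2) ∪ C0.biUnion blk0)
    (hc6 : D.card + R.card + (K + 2) * s ≤ Fintype.card V) :
    ∃ f : U → V, (∀ v ∈ D0, f v = f0 v) ∧ Emb t G D f ∧
      (D.filter (fun v => f v ∈ R)).card ≤ 2 * (C0.card + Lab.card) := by
  have hinv : ∀ c, ∃ y, c ∈ Lab.image c1 → y ∈ Lab ∧ c1 y = c := by
    intro c
    by_cases h : c ∈ Lab.image c1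
    · obtain ⟨y, hy, h⟩ := mem_image.1 h
      exact ⟨y, fun _ => ⟨hy, h⟩⟩
    · exact ⟨c, fun h' => absurd h' h⟩
  choose inv hinv using hinv
  let blk : U → Finset U := fun c => if c ∈ Lab.image c1 then {c, c2 (inv c)} else blk0 c
  have hblk1 : ∀ y ∈ Lab, blk (c1 y) = {c1 y, c2 y} := by
    intro y hy
    have hm : c1 y ∈ Lab.image c1 := mem_image_of_mem _ hy
    have h1 := hinv _ hm
    have : inv (c1 y) = y := hi1 _ h1.1 _ hy h1.2
    simp only [blk, if_pos hm, this]
  have hC0 : ∀ c ∈ C0, c ∉ Lab.image c1 := by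
    intro c hc h
    obtain ⟨y, hy, rfl⟩ := mem_image.1 h
    exact (b1' _ hc y hy).1 (b3 _ hc).1
  have hblk0 : ∀ c ∈ C0, blk c = blk0 c := by
    intro c hc
    simp only [blk, if_neg (hC0 c hc)]
  have hcase : ∀ c ∈ C0 ∪ Lab.image c1, c ∈ C0 ∨ ∃ y ∈ Lab, c1 y = c := by
    intro c hc
    rcases mem_union.1 hc with h | h
    · exact Or.inl h
    · exact Or.inr (mem_image.1 h)
  have hun : D = D0 ∪ (C0 ∪ Lab.image c1).biUnion blk := by
    rw [hD]
    ext v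
    simp only [mem_union, mem_biUnion]
    constructor
    · rintro ((h | h) | ⟨c, hc, hv⟩)
      · exact Or.inl h
      · right
        rcases h with h | h
        · obtain ⟨y, hy, rfl⟩ := mem_image.1 h
          exact ⟨c1 y, Or.inr h, by rw [hblk1 y hy]; simp⟩
        · obtain ⟨y, hy, rfl⟩ := mem_image.1 h
          exact ⟨c1 y, Or.inr (mem_image_of_mem _ hy), by rw [hblk1 y hy]; simp⟩
      · exact Or.inr ⟨c, Or.inl hc, by rw [hblk0 c hc]; exact hv⟩
    · rintro (h | ⟨c, hc, hv⟩)
      · exact Or.inl (Or.inl h)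
      · rcases hc with hc | hc
        · rw [hblk0 c hc] at hv
          exact Or.inr ⟨c, hc, hv⟩
        · obtain ⟨y, hy, rfl⟩ := mem_image.1 hc
          rw [hblk1 y hy, mem_insert, mem_singleton] at hv
          rcases hv with rfl | rfl
          · exact Or.inl (Or.inr (Or.inl hc))
          · exact Or.inl (Or.inr (Or.inr (mem_image_of_mem _ hy)))
  have hcc : (C0 ∪ Lab.image c1).card ≤ C0.card + Lab.card :=
    (card_union_le _ _).trans (Nat.add_le_add_left card_image_le _)
  obtain ⟨f, f1, f2, f3⟩ := embed_cuts t G s K dR hJ R hR D0 f0 h0 hR0 blk (C0 ∪ Lab.image c1)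
    (by
      intro c hc
      rcases hcase c hc with h | ⟨y, hy, rfl⟩
      · rw [hblk0 c h]; exact b1 c h
      · rw [hblk1 y hy, disjoint_left]
        intro v hv
        rw [mem_insert, mem_singleton] at hv
        obtain ⟨-, -, -, -, h1, h2⟩ := hq y hy
        rcases hv with rfl | rfl
        · exact h1
        · exact h2)
    (by
      have hx : ∀ c ∈ C0, ∀ y ∈ Lab, Disjoint (blk0 c) {c1 y, c2 y} := by
        intro c hc y hy
        rw [disjoint_right]
        intro v hv
        rw [mem_insert, mem_singleton] at hv
        rcases hv with rfl | rfl
        · exact (b1' c hc y hy).1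
        · exact (b1' c hc y hy).2
      intro c hc c' hc' hne
      rcases hcase c hc with h | ⟨y, hy, rfl⟩ <;> rcases hcase c' hc' with h' | ⟨y', hy', rfl⟩
      · rw [hblk0 c h, hblk0 c' h']; exact b2 c h c' h' hne
      · rw [hblk0 c h, hblk1 y' hy']; exact hx c h y' hy'
      · rw [hblk0 c' h', hblk1 y hy]; exact (hx c' h' y hy).symm
      · rw [hblk1 y hy, hblk1 y' hy', disjoint_left]
        intro v hv hv'
        rw [mem_insert, mem_singleton] at hv hv'
        have hyy : y ≠ y' := fun h => hne (by rw [h])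
        rcases hv with rfl | rfl <;> rcases hv' with hv' | hv'
        · exact hne hv'
        · exact hi3 y hy y' hy' hv'
        · exact hi3 y' hy' y hy hv'.symm
        · exact hyy (hi2 y hy y' hy' hv'))
    (by
      intro c hc
      rcases hcase c hc with h | ⟨y, hy, rfl⟩
      · rw [hblk0 c h]; exact b3 c h
      · obtain ⟨-, -, hp, hr, -, -⟩ := hq y hy
        rw [hblk1 y hy]
        refine ⟨by simp, ?_⟩
        intro v hv
        rw [mem_insert, mem_singleton] at hv
        rcases hv with rfl | rfl
        · exact ⟨le_rfl, fun h => absurd rfl h⟩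
        · refine ⟨?_, fun _ => ⟨by rw [hp]; simp, hr⟩⟩
          rw [← hp]
          exact (t.dep_par_lt _ hr).le)
    (by
      intro c hc
      rcases hcase c hc with h | ⟨y, hy, rfl⟩
      · left; rw [hblk0 c h]; exact ⟨b4 c h, b5 c h⟩
      · right
        obtain ⟨hqD, hp1, hp2, hr, -, -⟩ := hq y hy
        refine ⟨c2 y, q y, hblk1 y hy, (hi3 y hy y hy).symm, hqD, hp1, ?_⟩
        intro v hv hvr hpv
        rw [hblk1 y hy, mem_insert, mem_singleton] at hpv
        rcases hpv with h | h
        · exact absurd h (hu v hv hvr y hy).2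
        · exact (hu v hv hvr y hy).1 h)
    (by omega) (by rw [← hun]; exact hc6)
  rw [← hun] at f2 f3
  exact ⟨f, f1, f2, f3.trans (by omega)⟩

lemma RT.chain_uniq (t : RT U) (k : ℕ) (Y : Finset U) (hdep : ∀ v ∈ Y, k ≤ t.dep v)
    (hY : ∀ x ∈ Y, ∀ y ∈ Y, ∀ i < k, ∀ j < k, t.par^[i] x = t.par^[j] y → x = y) :
    ∀ x ∈ Y, ∀ y ∈ Y, ∀ i < k, ∀ j < k, t.par^[i] x = t.par^[j] y → x = y ∧ i = j := by
  intro x hx y hy i hi j hj h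
  have hxy := hY x hx y hy i hi j hj h
  subst hxy
  refine ⟨rfl, ?_⟩
  have h1 := congrArg t.dep h
  rw [t.dep_iter, t.dep_iter] at h1
  have := hdep x hx
  omega

end ST

end

section
open Finset
open scoped Classical

set_option linter.unusedSectionVars false
namespace ST
variable {U V : Type*} [Fintype U] [Fintype V]

/-- completing an embedding by a matching of the leaves -/
lemma finishA (t : RT U) (G : SimpleGraph V) (s : ℕ) (hJ : Joined G s)
    (hUV : Fintype.card U = Fintype.card V)
    (L0 Ls : Finset U) (hleaf : ∀ v ∈ L0, (t.ch v).card = 0) (hroot : ∀ v ∈ L0, v ≠ t.root)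
    (hparinj : ∀ x ∈ L0, ∀ y ∈ L0, t.par x = t.par y → x = y) (hsub : Ls ⊆ L0)
    (f : U → V) (hf : Emb t G (univ \ L0) f)
    (hdegW : ∀ v, s ≤ (nb G v \ (univ \ L0).image f).card)
    (hdegQ : ∀ v, s ≤ (Ls.filter (fun y => G.Adj v (f (t.par y)))).card) :
    ∃ F : U → V, Emb t G univ F := by
  set W : Finset V := univ \ (univ \ L0).image f with hW
  have hWc : W.card = L0.card := by
    have h1 : ((univ \ L0).image f).card = (univ \ L0).card := card_image_of_injOn hf.1
    have h2 := card_sdiff_add_card_eq_card (subset_univ L0)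
    have h3 := card_sdiff_add_card_eq_card (subset_univ ((univ \ L0).image f))
    rw [card_univ] at h2 h3
    rw [← hW] at h3
    omega
  have hpar : ∀ v ∈ L0, t.par v ∉ L0 := by
    intro v hv hp
    have := hleaf _ hp
    rw [card_eq_zero] at this
    have h2 : v ∈ t.ch (t.par v) := RT.mem_ch.2 ⟨hroot v hv, rfl⟩
    rw [this] at h2
    simp at h2
  have hparm : ∀ v ∈ L0, t.par v ∈ univ \ L0 := fun v hv =>
    mem_sdiff.2 ⟨mem_univ _, hpar v hv⟩
  have hall : ∀ S : Finset {x // x ∈ L0}, S.card ≤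
      (S.biUnion (fun x => nb G (f (t.par x.1)) ∩ W)).card := by
    intro S
    set B := S.biUnion (fun x => nb G (f (t.par x.1)) ∩ W) with hB
    rcases S.eq_empty_or_nonempty with rfl | ⟨x0, hx0⟩
    · simp
    have hS' : S.card ≤ L0.card := by
      have := card_le_univ S
      simpa using this
    by_cases h1 : S.card ≤ s
    · refine h1.trans ((hdegW (f (t.par x0.1))).trans (card_le_card ?_))
      intro w hw
      rw [mem_sdiff] at hw
      exact mem_biUnion.2 ⟨x0, hx0, mem_inter.2 ⟨hw.1, mem_sdiff.2 ⟨mem_univ _, hw.2⟩⟩⟩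
    by_cases h2 : S.card + s ≤ L0.card
    · set P := S.image (fun x => f (t.par x.1)) with hP
      have hPc : P.card = S.card := by
        apply card_image_of_injective
        intro a b hab
        have := hf.1 (by exact_mod_cast hparm a.1 a.2) (by exact_mod_cast hparm b.1 b.2) hab
        exact Subtype.ext (hparinj a.1 a.2 b.1 b.2 this)
      have hd : Disjoint P W := by
        rw [disjoint_left]
        intro v hv hvW
        obtain ⟨x, -, rfl⟩ := mem_image.1 hv
        exact (mem_sdiff.1 hvW).2 (mem_image_of_mem _ (hparm x.1 x.2))
      have h3 := nbs_card_lt hJ P W hd (by omega)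
      have h4 : nbs G P W ⊆ B := by
        intro w hw
        obtain ⟨hwW, p, hp, hpw⟩ := mem_filter.1 hw
        obtain ⟨x, hx, rfl⟩ := mem_image.1 hp
        exact mem_biUnion.2 ⟨x, hx, mem_inter.2 ⟨mem_nb.2 hpw, hwW⟩⟩
      have := card_le_card h4
      omega
    · have h4 : W ⊆ B := by
        intro w hw
        have h5 := hdegQ w
        have h6 : (S.map (Function.Embedding.subtype _)).card = S.card := card_map _
        have h7 : S.map (Function.Embedding.subtype _) ⊆ L0 := by
          intro v hv
          obtain ⟨x, -, rfl⟩ := mem_map.1 hv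
          exact x.2
        have h8 : 0 < (Ls.filter (fun y => G.Adj w (f (t.par y))) ∩
            S.map (Function.Embedding.subtype _)).card := by
          have h9 := card_union_add_card_inter (Ls.filter (fun y => G.Adj w (f (t.par y))))
            (S.map (Function.Embedding.subtype _))
          have h10 : (Ls.filter (fun y => G.Adj w (f (t.par y))) ∪
              S.map (Function.Embedding.subtype _)).card ≤ L0.card :=
            card_le_card (union_subset ((filter_subset _ _).trans hsub) h7)
          omega
        obtain ⟨y, hy⟩ := card_pos.1 h8
        rw [mem_inter, mem_filter] at hy
        obtain ⟨x, hx, rfl⟩ := mem_map.1 hy.2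
        exact mem_biUnion.2 ⟨x, hx, mem_inter.2 ⟨mem_nb.2 hy.1.2.symm, hw⟩⟩
      have := card_le_card h4
      omega
  obtain ⟨g, hg1, hg2⟩ := (Finset.all_card_le_biUnion_card_iff_exists_injective _).1 hall
  have hgW : ∀ x, g x ∉ (univ \ L0).image f := fun x =>
    (mem_sdiff.1 (mem_inter.1 (hg2 x)).2).2
  refine ⟨fun u => if h : u ∈ L0 then g ⟨u, h⟩ else f u, ?_, ?_⟩
  · intro a _ b _ hab
    by_cases ha : a ∈ L0 <;> by_cases hb : b ∈ L0
    · simp only [dif_pos ha, dif_pos hb] at hab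
      exact congrArg Subtype.val (hg1 hab)
    · simp only [dif_pos ha, dif_neg hb] at hab
      exact absurd (hab ▸ mem_image_of_mem f (mem_sdiff.2 ⟨mem_univ _, hb⟩)) (hgW ⟨a, ha⟩)
    · simp only [dif_neg ha, dif_pos hb] at hab
      exact absurd (hab ▸ mem_image_of_mem f (mem_sdiff.2 ⟨mem_univ _, ha⟩)) (hgW ⟨b, hb⟩)
    · simp only [dif_neg ha, dif_neg hb] at hab
      exact hf.1 (by simpa using ha) (by simpa using hb) hab
  · intro v _ hvr _
    have hp : t.par v ∉ L0 := by
      intro hp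
      have := hleaf _ hp
      rw [card_eq_zero] at this
      have h2 : v ∈ t.ch (t.par v) := RT.mem_ch.2 ⟨hvr, rfl⟩
      rw [this] at h2
      simp at h2
    simp only [dif_neg hp]
    by_cases hv : v ∈ L0
    · simp only [dif_pos hv]
      exact (mem_nb.1 (mem_inter.1 (hg2 ⟨v, hv⟩)).1).symm
    · simp only [dif_neg hv]
      exact hf.2 v (by simpa using hv) hvr (by simpa using hp)

set_option maxHeartbeats 800000 in
theorem caseA [Nonempty V] (t : RT U) {Δ : ℕ} (hΔ : ∀ v, (t.ch v).card ≤ Δ) (hΔ1 : 0 < Δ)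
    (G : SimpleGraph V) (hUV : Fintype.card U = Fintype.card V) (s d e h r dR : ℕ) (hh : 0 < h)
    (hJ : Joined G s) (hd : ∀ v, d ≤ (nb G v).card) (he : Fintype.card V ≤ e * d)
    (L0 Ls : Finset U) (hleaf : ∀ v ∈ L0, (t.ch v).card = 0) (hdep : ∀ v ∈ L0, 4 ≤ t.dep v)
    (hch : ∀ x ∈ L0, ∀ y ∈ L0, ∀ i < 4, ∀ j < 4, t.par^[i] x = t.par^[j] y → x = y)
    (hsub : Ls ⊆ L0) (h1 : 12 * e * s ≤ Ls.card) (h2 : 2 * (Ls.card + r) ≤ d)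
    (h3 : 12 * e * dR ≤ r) (h4 : Fintype.card V ≤ 2 ^ s)
    (h5 : 2 * (1 + Fintype.card V / h + (3 * Δ + 1) * Ls.card) + 2 * s ≤ dR)
    (h6 : r + (h * Δ ^ h + 2) * s ≤ L0.card) :
    ∃ F : U → V, Emb t G univ F := by
  have hun := t.chain_uniq 4 L0 hdep hch
  have hunS : ∀ x ∈ Ls, ∀ y ∈ L0, ∀ i < 4, ∀ j < 4, t.par^[i] x = t.par^[j] y → x = y ∧ i = j :=
    fun x hx y hy => hun x (hsub hx) y hy
  have hunSS : ∀ x ∈ Ls, ∀ y ∈ Ls, ∀ i < 4, ∀ j < 4, t.par^[i] x = t.par^[j] y → x = y ∧ i = j :=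
    fun x hx y hy => hun x (hsub hx) y (hsub hy)
  have hnr : ∀ x ∈ L0, ∀ i < 4, t.par^[i] x ≠ t.root := by
    intro x hx i hi
    apply t.ne_root_of_dep
    rw [t.dep_iter]
    have := hdep x hx
    omega
  set Q := Ls.image (fun y => t.par^[1] y) with hQ
  have hQc : Q.card = Ls.card := by
    apply card_image_of_injOn
    intro a ha b hb hab
    exact (hunSS a ha b hb 1 (by norm_num) 1 (by norm_num) hab).1
  obtain ⟨τ, -, τ2, τ3⟩ := floats G d e s hd he ∅ Q (by rw [card_empty, hQc]; omega)
    (by rw [hQc]; exact h1) h4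
  have hQimg : (Q.image τ).card ≤ Ls.card := card_image_le.trans hQc.le
  have hsdR : s ≤ dR := by omega
  obtain ⟨R, hRc, hRd, hRn⟩ := reserve G d e dR r hd he (Q.image τ) (by omega) h3
    (h4.trans (Nat.pow_le_pow_right (by norm_num) hsdR))
  set c2 : U → U := fun y => t.par^[2] y with hc2
  set c1 : U → U := fun y => t.par^[3] y with hc1
  set E := Q ∪ (Ls.image c1 ∪ Ls.image c2) ∪ L0 with hE
  have hQE : Q ⊆ E := subset_union_left.trans subset_union_left
  have hc1E : ∀ y ∈ Ls, c1 y ∈ E := fun y hy =>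
    mem_union_left _ (mem_union_right _ (mem_union_left _ (mem_image_of_mem _ hy)))
  have hc2E : ∀ y ∈ Ls, c2 y ∈ E := fun y hy =>
    mem_union_left _ (mem_union_right _ (mem_union_right _ (mem_image_of_mem _ hy)))
  obtain ⟨r0, hr0, hcuts⟩ := t.cuts_card E h hh
  obtain ⟨blk, k1, k2, k3, k4, k5⟩ := t.blocks hΔ hΔ1 E h r0 hr0
  have hfront : (univ.filter (fun v => v ∉ E ∧ v ≠ t.root ∧ t.par v ∈ E)).card ≤
      3 * Δ * Ls.card := by
    have hs : univ.filter (fun v => v ∉ E ∧ v ≠ t.root ∧ t.par v ∈ E) ⊆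
        (Q ∪ (Ls.image c1 ∪ Ls.image c2)).biUnion t.ch := by
      intro v hv
      simp only [mem_filter, mem_univ, true_and] at hv
      obtain ⟨-, hvr, hvp⟩ := hv
      rw [hE, mem_union] at hvp
      rcases hvp with hvp | hvp
      · exact mem_biUnion.2 ⟨_, hvp, RT.mem_ch.2 ⟨hvr, rfl⟩⟩
      · have := hleaf _ hvp
        rw [card_eq_zero] at this
        have h2 : v ∈ t.ch (t.par v) := RT.mem_ch.2 ⟨hvr, rfl⟩
        rw [this] at h2
        simp at h2
    refine (card_le_card hs).trans ((card_biUnion_le_card_mul _ _ Δ (fun v _ => hΔ v)).trans ?_)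
    have e1 := card_union_le Q (Ls.image c1 ∪ Ls.image c2)
    have e2 := card_union_le (Ls.image c1) (Ls.image c2)
    have e3 : (Ls.image c1).card ≤ Ls.card := card_image_le
    have e4 : (Ls.image c2).card ≤ Ls.card := card_image_le
    calc _ ≤ (3 * Ls.card) * Δ := Nat.mul_le_mul_right _ (by omega)
      _ = _ := by ring
  have hDD : univ \ L0 = Q ∪ (Ls.image c1 ∪ Ls.image c2) ∪ (t.cuts E h r0).biUnion blk := by
    rw [k5]
    ext v
    simp only [mem_sdiff, mem_univ, true_and]
    constructor
    · intro hv
      by_cases hvE : v ∈ E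
      · rw [hE, mem_union] at hvE
        exact mem_union_left _ (hvE.resolve_right hv)
      · exact mem_union_right _ (mem_sdiff.2 ⟨mem_univ _, hvE⟩)
    · intro hv hvL
      rcases mem_union.1 hv with hv | hv
      · rcases mem_union.1 hv with hv | hv
        · obtain ⟨y, hy, rfl⟩ := mem_image.1 hv
          have := (hunS y hy _ hvL 1 (by norm_num) 0 (by norm_num) rfl).2
          omega
        · rcases mem_union.1 hv with hv | hv
          · obtain ⟨y, hy, rfl⟩ := mem_image.1 hv
            have := (hunS y hy _ hvL 3 (by norm_num) 0 (by norm_num) rfl).2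
            omega
          · obtain ⟨y, hy, rfl⟩ := mem_image.1 hv
            have := (hunS y hy _ hvL 2 (by norm_num) 0 (by norm_num) rfl).2
            omega
      · exact (mem_sdiff.1 hv).2 (mem_union_right _ hvL)
  have hCc : (t.cuts E h r0).card + Ls.card ≤ 1 + Fintype.card V / h + (3 * Δ + 1) * Ls.card := by
    rw [hUV] at hcuts
    have : (3 * Δ + 1) * Ls.card = 3 * Δ * Ls.card + Ls.card := by ring
    omega
  obtain ⟨f, f1, f2, f3⟩ := embed_mix t G s (h * Δ ^ h) dR hJ R hRn Q τ
    ⟨by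
      intro a ha b hb hab
      by_contra hne
      exact τ2 a ha b hb hne hab, by
      intro v hv hvr hpv
      obtain ⟨y, hy, rfl⟩ := mem_image.1 hv
      obtain ⟨y', hy', hyy⟩ := mem_image.1 hpv
      have hyy : t.par^[1] y' = t.par^[2] y := hyy
      have := (hunSS y' hy' y hy 1 (by norm_num) 2 (by norm_num) hyy).2
      omega⟩
    hRd Ls (fun y => t.par^[1] y) c2 c1
    (by
      intro y hy
      refine ⟨mem_image_of_mem _ hy, rfl, rfl, hnr y (hsub hy) 2 (by norm_num), ?_, ?_⟩
      · intro hm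
        obtain ⟨y', hy', hyy⟩ := mem_image.1 hm
        have := (hunSS y' hy' y hy 1 (by norm_num) 3 (by norm_num) hyy).2
        omega
      · intro hm
        obtain ⟨y', hy', hyy⟩ := mem_image.1 hm
        have := (hunSS y' hy' y hy 1 (by norm_num) 2 (by norm_num) hyy).2
        omega)
    (fun y hy y' hy' hyy => (hunSS y hy y' hy' 3 (by norm_num) 3 (by norm_num) hyy).1)
    (fun y hy y' hy' hyy => (hunSS y hy y' hy' 2 (by norm_num) 2 (by norm_num) hyy).1)
    (fun y hy y' hy' hyy => by
      have := (hunSS y hy y' hy' 3 (by norm_num) 2 (by norm_num) hyy).2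
      omega)
    (by
      intro v hv hvr y hy
      obtain ⟨y', hy', rfl⟩ := mem_image.1 hv
      constructor
      · intro hyy
        have : t.par^[2] y' = t.par^[2] y := hyy
        have := (hunSS y' hy' y hy 2 (by norm_num) 2 (by norm_num) this).1
        simp only [this]
      · intro hyy
        have : t.par^[2] y' = t.par^[3] y := hyy
        have := (hunSS y' hy' y hy 2 (by norm_num) 3 (by norm_num) this).2
        omega)
    blk (t.cuts E h r0) (fun c hc => (k1 c hc).mono_right hQE)
    (fun c hc y hy => ⟨fun hm => disjoint_left.1 (k1 c hc) hm (hc1E y hy),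
      fun hm => disjoint_left.1 (k1 c hc) hm (hc2E y hy)⟩) k2 k3 k4
    (by
      intro c hc v hv hvr hm
      obtain ⟨y, hy, rfl⟩ := mem_image.1 hv
      exact disjoint_left.1 (k1 c hc) hm (hc2E y hy))
    (by omega) (univ \ L0) hDD (by
      have := card_sdiff_add_card_eq_card (subset_univ L0)
      rw [card_univ] at this
      omega)
  refine finishA t G s hJ hUV L0 Ls hleaf (fun v hv => hnr v hv 0 (by norm_num))
    (fun x hx y hy hxy => (hun x hx y hy 1 (by norm_num) 1 (by norm_num) hxy).1) hsub f f2 ?_ ?_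
  · intro v
    have e1 := hRn v
    have e2 : (nb G v ∩ R) \ (((univ \ L0).filter (fun v => f v ∈ R)).image f) ⊆
        nb G v \ (univ \ L0).image f := by
      intro x hx
      simp only [mem_sdiff, mem_inter] at hx
      refine mem_sdiff.2 ⟨hx.1.1, ?_⟩
      intro hm
      obtain ⟨u, hu, rfl⟩ := mem_image.1 hm
      exact hx.2 (mem_image_of_mem _ (mem_filter.2 ⟨hu, hx.1.2⟩))
    have e3 := card_le_card e2
    have e4 := le_card_sdiff (((univ \ L0).filter (fun v => f v ∈ R)).image f) (nb G v ∩ R)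
    have e5 : (((univ \ L0).filter (fun v => f v ∈ R)).image f).card ≤ _ := card_image_le
    omega
  · intro v
    refine (τ3 v).trans ?_
    have : (Q.filter (fun y => G.Adj v (τ y))) ⊆
        (Ls.filter (fun y => G.Adj v (f (t.par y)))).image (fun y => t.par^[1] y) := by
      intro u hu
      obtain ⟨huQ, hu2⟩ := mem_filter.1 hu
      obtain ⟨y, hy, rfl⟩ := mem_image.1 huQ
      refine mem_image.2 ⟨y, mem_filter.2 ⟨hy, ?_⟩, rfl⟩
      have := f1 _ huQ
      change G.Adj v (f (t.par^[1] y))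
      rw [this]; exact hu2
    exact (card_le_card this).trans card_image_le

end ST

end

section
open Finset
open scoped Classical

set_option linter.unusedSectionVars false
namespace ST
variable {U V : Type*} [Fintype U] [Fintype V]

def sg (i : ℕ) : ℕ := [0, 2, 3, 4, 5, 9, 8, 7, 6, 1, 10].getD i 0

lemma sg_lt : ∀ i < 11, sg i < 11 := by decide
lemma sg_inj : ∀ i < 11, ∀ j < 11, sg i = sg j → i = j := by decide

lemma switch (t : RT U) (G : SimpleGraph V) (D : Finset U) (f : U → V) (hf : Emb t G D f) (v : U)
    (hdep : 11 ≤ t.dep v) (hD : ∀ i < 11, t.par^[i] v ∈ D)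
    (huc : ∀ u, u ≠ t.root → ∀ i < 10, t.par u = t.par^[i + 1] v → u = t.par^[i] v)
    (hg : IsGad G (fun i => f (t.par^[i] v))) (w : V) (hw : w ∉ D.image f)
    (hw1 : G.Adj w (f (t.par^[10] v))) (hw2 : G.Adj w (f (t.par^[6] v))) :
    ∃ f' : U → V, Emb t G D f' ∧
      (∀ u, (∀ i, 1 ≤ i → i < 10 → u ≠ t.par^[i] v) → f' u = f u) ∧
      f (t.par^[1] v) ∉ D.image f' ∧ D.image f' ⊆ insert w (D.image f) := by
  set ch := (range 11).image (fun i => t.par^[i] v) with hch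
  set val : ℕ → V := fun i => if i = 9 then w else f (t.par^[sg i] v) with hval
  let f' : U → V := fun u => if u ∈ ch then val (t.dep v - t.dep u) else f u
  have hin : ∀ i < 11, t.par^[i] v ∈ ch := fun i hi => mem_image_of_mem _ (mem_range.2 hi)
  have hf1 : ∀ i < 11, f' (t.par^[i] v) = val i := by
    intro i hi
    simp only [f', if_pos (hin i hi), t.dep_iter]
    congr 1
    omega
  have hf2 : ∀ u, u ∉ ch → f' u = f u := fun u hu => by simp only [f', if_neg hu]
  have hchx : ∀ u ∈ ch, ∃ i < 11, t.par^[i] v = u := by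
    intro u hu
    obtain ⟨i, hi, rfl⟩ := mem_image.1 hu
    exact ⟨i, mem_range.1 hi, rfl⟩
  have hv0 : val 0 = f v := rfl
  have hv10 : val 10 = f (t.par^[10] v) := rfl
  have hwne : ∀ u ∈ D, f u ≠ w := fun u hu h => hw (h ▸ mem_image_of_mem f hu)
  have hvinj : ∀ i < 11, ∀ j < 11, val i = val j → i = j := by
    intro i hi j hj hij
    simp only [hval] at hij
    split_ifs at hij with h1 h2 h2
    · omega
    · exact absurd hij.symm (hwne _ (hD _ (sg_lt j hj)))
    · exact absurd hij (hwne _ (hD _ (sg_lt i hi)))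
    · exact sg_inj i hi j hj (hg.inj _ (sg_lt i hi) _ (sg_lt j hj) hij)
  have hvout : ∀ i < 11, ∀ u ∈ D, u ∉ ch → val i ≠ f u := by
    intro i hi u hu huc h
    simp only [hval] at h
    split_ifs at h with h1
    · exact hwne u hu h.symm
    · have := hf.1 (by exact_mod_cast hD _ (sg_lt i hi)) (by exact_mod_cast hu) h
      exact huc (this ▸ hin _ (sg_lt i hi))
  have hpath : ∀ i < 10, G.Adj (val i) (val (i + 1)) := by
    have p := hg.path
    intro i hi
    interval_cases i
    · exact hg.a20.symm
    · exact p 2 (by norm_num)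
    · exact p 3 (by norm_num)
    · exact p 4 (by norm_num)
    · exact hg.a95.symm
    · exact (p 8 (by norm_num)).symm
    · exact (p 7 (by norm_num)).symm
    · exact (p 6 (by norm_num)).symm
    · exact hw2.symm
    · exact hw1
  refine ⟨f', ⟨?_, ?_⟩, ?_, ?_, ?_⟩
  · intro a ha b hb hab
    by_cases hac : a ∈ ch <;> by_cases hbc : b ∈ ch
    · obtain ⟨i, hi, rfl⟩ := hchx a hac
      obtain ⟨j, hj, rfl⟩ := hchx b hbc
      rw [hf1 i hi, hf1 j hj] at hab
      rw [hvinj i hi j hj hab]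
    · obtain ⟨i, hi, rfl⟩ := hchx a hac
      rw [hf1 i hi, hf2 b hbc] at hab
      exact absurd hab (hvout i hi b hb hbc)
    · obtain ⟨j, hj, rfl⟩ := hchx b hbc
      rw [hf1 j hj, hf2 a hac] at hab
      exact absurd hab.symm (hvout j hj a ha hac)
    · rw [hf2 a hac, hf2 b hbc] at hab
      exact hf.1 ha hb hab
  · intro u hu hur hpu
    by_cases huch : u ∈ ch
    · obtain ⟨i, hi, rfl⟩ := hchx u huch
      rw [← Function.iterate_succ_apply' (f := t.par)] at hpu ⊢
      by_cases hi10 : i < 10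
      · rw [hf1 i hi, hf1 (i + 1) (by omega)]
        exact hpath i hi10
      · have hi' : i = 10 := by omega
        subst hi'
        have hnot : t.par^[11] v ∉ ch := by
          intro h
          obtain ⟨j, hj, hjj⟩ := hchx _ h
          have := congrArg t.dep hjj
          rw [t.dep_iter, t.dep_iter] at this
          omega
        rw [hf1 10 hi, hf2 _ hnot, hv10, Function.iterate_succ_apply' (f := t.par)]
        rw [Function.iterate_succ_apply' (f := t.par)] at hpu
        exact hf.2 _ hu hur hpu
    · rw [hf2 u huch]
      by_cases hpc : t.par u ∈ ch
      · obtain ⟨j, hj, hjj⟩ := hchx _ hpc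
        rcases Nat.eq_zero_or_pos j with h0 | h0
        · subst h0
          rw [← hjj, hf1 0 hj, hv0]
          have := hf.2 u hu hur hpu
          rw [← hjj] at this
          exact this
        · obtain ⟨i, rfl⟩ := Nat.exists_eq_succ_of_ne_zero h0.ne'
          have := huc u hur i (by omega) hjj.symm
          exact absurd (this ▸ hin i (by omega)) huch
      · rw [hf2 _ hpc]
        exact hf.2 u hu hur hpu
  · intro u hu
    by_cases huch : u ∈ ch
    · obtain ⟨i, hi, rfl⟩ := hchx u huch
      rw [hf1 i hi]
      have : i = 0 ∨ i = 10 := by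
        by_contra hcon
        exact hu i (by omega) (by omega) rfl
      rcases this with rfl | rfl
      · rfl
      · rfl
    · exact hf2 u huch
  · intro hm
    obtain ⟨u, hu, huf⟩ := mem_image.1 hm
    by_cases huch : u ∈ ch
    · obtain ⟨i, hi, rfl⟩ := hchx u huch
      rw [hf1 i hi] at huf
      simp only [hval] at huf
      split_ifs at huf with h9
      · exact hwne _ (hD 1 (by norm_num)) huf.symm
      · have h1 := hg.inj _ (sg_lt i hi) 1 (by norm_num) huf
        exact h9 (sg_inj i hi 9 (by norm_num) h1)
    · rw [hf2 u huch] at huf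
      have := hf.1 (by exact_mod_cast hu) (by exact_mod_cast hD 1 (by norm_num)) huf
      exact huch (this ▸ hin 1 (by norm_num))
  · intro x hx
    obtain ⟨u, hu, rfl⟩ := mem_image.1 hx
    by_cases huch : u ∈ ch
    · obtain ⟨i, hi, rfl⟩ := hchx u huch
      rw [hf1 i hi]
      simp only [hval]
      split_ifs
      · exact mem_insert_self _ _
      · exact mem_insert_of_mem (mem_image_of_mem f (hD _ (sg_lt i hi)))
    · rw [hf2 u huch]
      exact mem_insert_of_mem (mem_image_of_mem f hu)

end ST

end

section
open Finset
open scoped Classical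

set_option linter.unusedSectionVars false
namespace ST
variable {U V : Type*} [Fintype U] [Fintype V]

/-- the vertices postponed to the end -/
noncomputable def RT.del (t : RT U) (Dl : Finset U) : Finset U :=
  Dl.image (fun v => t.par^[1] v) ∪ Dl.image (fun v => t.par^[2] v)

lemma RT.mem_del {t : RT U} {Dl : Finset U} {u : U} :
    u ∈ t.del Dl ↔ ∃ v ∈ Dl, ∃ i, 1 ≤ i ∧ i < 3 ∧ t.par^[i] v = u := by
  simp only [RT.del, mem_union, mem_image]
  constructor
  · rintro (⟨v, hv, h⟩ | ⟨v, hv, h⟩)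
    · exact ⟨v, hv, 1, by norm_num, by norm_num, h⟩
    · exact ⟨v, hv, 2, by norm_num, by norm_num, h⟩
  · rintro ⟨v, hv, i, h1, h3, h⟩
    have : i = 1 ∨ i = 2 := by omega
    rcases this with rfl | rfl
    · exact Or.inl ⟨v, hv, h⟩
    · exact Or.inr ⟨v, hv, h⟩

set_option maxHeartbeats 800000 in
lemma finishB (t : RT U) (G : SimpleGraph V) (s : ℕ) (hJ : Joined G s)
    (hUV : Fintype.card U = Fintype.card V) (Y0 : Finset U) (hdep : ∀ v ∈ Y0, 13 ≤ t.dep v)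
    (hun : ∀ x ∈ Y0, ∀ y ∈ Y0, ∀ i < 13, ∀ j < 13, t.par^[i] x = t.par^[j] y → x = y ∧ i = j)
    (huc : ∀ v ∈ Y0, ∀ u, u ≠ t.root → ∀ i < 12, t.par u = t.par^[i + 1] v → u = t.par^[i] v)
    (Dl : Finset U) : ∀ (Gs : Finset U) (f : U → V), Dl ⊆ Y0 → Gs ⊆ Y0 → Disjoint Dl Gs →
    Emb t G (univ \ t.del Dl) f → (∀ g ∈ Gs, IsGad G (fun i => f (t.par^[i] g))) →
    (∀ w x, 2 * Dl.card + 2 * s ≤ (Gs.filter (fun g => GoodG G w x (fun i => f (t.par^[i] g)))).card) →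
    ∃ F : U → V, Emb t G univ F := by
  induction Dl using Finset.induction_on with
  | empty =>
    intro Gs f _ _ _ hf _ _
    refine ⟨f, ?_⟩
    have : univ \ t.del (∅ : Finset U) = univ := by simp [RT.del]
    rwa [this] at hf
  | insert v Dl hv ih =>
    intro Gs f hDl hGs hdis hf hgad hcnt
    set D := univ \ t.del (insert v Dl) with hDdef
    have hvY : v ∈ Y0 := hDl (mem_insert_self _ _)
    have hmemD : ∀ u, u ∈ D ↔ ∀ y ∈ insert v Dl, ∀ i, 1 ≤ i → i < 3 → t.par^[i] y ≠ u := by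
      intro u
      rw [hDdef, mem_sdiff, RT.mem_del]
      simp only [mem_univ, true_and]
      push Not
      rfl
    have hgD : ∀ g ∈ Gs, ∀ i < 13, t.par^[i] g ∈ D := by
      intro g hg i hi
      rw [hmemD]
      intro y hy j _ hj h
      have := (hun y (hDl hy) g (hGs hg) j (by omega) i hi h).1
      subst this
      exact disjoint_left.1 hdis hy hg
    have hvi : ∀ i, i = 0 ∨ i = 3 → t.par^[i] v ∈ D := by
      intro i hi
      rw [hmemD]
      intro y hy j h1 h3 h
      have := (hun y (hDl hy) v hvY j (by omega) i (by omega) h).2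
      omega
    have hvj : ∀ i, 1 ≤ i → i < 3 → t.par^[i] v ∉ D := by
      intro i h1 h3 h
      rw [hmemD] at h
      exact h v (mem_insert_self _ _) i h1 h3 rfl
    have hp12 : t.par^[1] v ≠ t.par^[2] v := by
      intro h
      have := (hun v hvY v hvY 1 (by norm_num) 2 (by norm_num) h).2
      omega
    -- free vertices
    have hcard : 1 < (univ \ D.image f).card := by
      have h1 : (D.image f).card ≤ D.card := card_image_le
      have h2 := card_sdiff_add_card_eq_card (subset_univ (D.image f))
      have h3 : D.card + ({t.par^[1] v, t.par^[2] v} : Finset U).card ≤ Fintype.card U := by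
        rw [← card_union_of_disjoint]
        · exact card_le_univ _
        · rw [disjoint_right]
          intro u hu
          rw [mem_insert, mem_singleton] at hu
          rcases hu with rfl | rfl
          · exact hvj 1 (by norm_num) (by norm_num)
          · exact hvj 2 (by norm_num) (by norm_num)
      rw [card_pair hp12] at h3
      rw [card_univ] at h2
      omega
    obtain ⟨w1, hw1, w2, hw2, hw12⟩ := one_lt_card.1 hcard
    replace hw1 := (mem_sdiff.1 hw1).2
    replace hw2 := (mem_sdiff.1 hw2).2
    set x := f (t.par^[3] v) with hx
    set y := f v with hy
    have c1 := hcnt w1 x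
    have c2 := hcnt w2 y
    obtain ⟨A1, hA1, hA1c⟩ := exists_subset_card_eq (n := s)
      (s := Gs.filter (fun g => GoodG G w1 x (fun i => f (t.par^[i] g)))) (by omega)
    obtain ⟨A2, hA2, hA2c⟩ := exists_subset_card_eq (n := s)
      (s := (Gs.filter (fun g => GoodG G w2 y (fun i => f (t.par^[i] g)))) \ A1) (by
        have := le_card_sdiff A1 (Gs.filter (fun g => GoodG G w2 y (fun i => f (t.par^[i] g))))
        omega)
    have hA1G : ∀ g ∈ A1, g ∈ Gs := fun g hg => (mem_filter.1 (hA1 hg)).1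
    have hA2G : ∀ g ∈ A2, g ∈ Gs := fun g hg => (mem_filter.1 (mem_sdiff.1 (hA2 hg)).1).1
    have hzinj : ∀ g ∈ Gs, ∀ g' ∈ Gs, f (t.par^[1] g) = f (t.par^[1] g') → g = g' := by
      intro g hg g' hg' h
      have := hf.1 (by exact_mod_cast hgD g hg 1 (by norm_num))
        (by exact_mod_cast hgD g' hg' 1 (by norm_num)) h
      exact (hun g (hGs hg) g' (hGs hg') 1 (by norm_num) 1 (by norm_num) this).1
    obtain ⟨z1, hz1, z2, hz2, hz12⟩ := hJ (A1.image (fun g => f (t.par^[1] g)))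
      (A2.image (fun g => f (t.par^[1] g))) (by
        rw [disjoint_left]
        intro z hz hz'
        obtain ⟨g, hg, rfl⟩ := mem_image.1 hz
        obtain ⟨g', hg', h⟩ := mem_image.1 hz'
        have := hzinj g' (hA2G g' hg') g (hA1G g hg) h
        subst this
        exact (mem_sdiff.1 (hA2 hg')).2 hg)
      (by
        rw [card_image_of_injOn, hA1c]
        intro a ha b hb hab
        exact hzinj a (hA1G a ha) b (hA1G b hb) hab)
      (by
        rw [card_image_of_injOn, hA2c]
        intro a ha b hb hab
        exact hzinj a (hA2G a ha) b (hA2G b hb) hab)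
    obtain ⟨g1, hg1A, rfl⟩ := mem_image.1 hz1
    obtain ⟨g2, hg2A, rfl⟩ := mem_image.1 hz2
    have hg1 := hA1G g1 hg1A
    have hg2 := hA2G g2 hg2A
    have hg12 : g1 ≠ g2 := by
      rintro rfl
      exact (mem_sdiff.1 (hA2 hg2A)).2 hg1A
    obtain ⟨a1, a2, a3⟩ := (mem_filter.1 (hA1 hg1A)).2
    obtain ⟨b1, b2, b3⟩ := (mem_filter.1 (mem_sdiff.1 (hA2 hg2A)).1).2
    -- first switch
    obtain ⟨f1, e1, e2, e3, e4⟩ := switch t G D f hf g1 (by have := hdep g1 (hGs hg1); omega)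
      (fun i hi => hgD g1 hg1 i (by omega))
      (fun u hu i hi h => huc g1 (hGs hg1) u hu i (by omega) h) (hgad g1 hg1) w1 hw1 a1 a2
    have hne1 : ∀ z ∈ Y0, z ≠ g1 → ∀ i < 13, f1 (t.par^[i] z) = f (t.par^[i] z) := by
      intro z hz hzg i hi
      apply e2
      intro j _ hj h
      exact hzg (hun z hz g1 (hGs hg1) i hi j (by omega) h).1
    have hg2f : (fun i => f (t.par^[i] g2)) 10 = f1 (t.par^[10] g2) :=
      (hne1 g2 (hGs hg2) hg12.symm 10 (by norm_num)).symm
    have hgcopy : ∀ g ∈ Gs, ∀ h : U → V, (∀ i < 13, h (t.par^[i] g) = f (t.par^[i] g)) →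
        IsGad G (fun i => h (t.par^[i] g)) := by
      intro g hg h hh
      have h0 := hgad g hg
      refine ⟨?_, ?_, ?_, ?_⟩
      · intro i hi j hj hij
        simp only [hh i (by omega), hh j (by omega)] at hij
        exact h0.inj i hi j hj hij
      · intro i hi
        simp only [hh i (by omega), hh (i + 1) (by omega)]
        exact h0.path i hi
      · simp only [hh 2 (by omega), hh 0 (by omega)]
        exact h0.a20
      · simp only [hh 9 (by omega), hh 5 (by omega)]
        exact h0.a95
    have hw2' : w2 ∉ D.image f1 := by
      intro h
      rcases mem_insert.1 (e4 h) with h | h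
      · exact hw12 h.symm
      · exact hw2 h
    obtain ⟨f2, d1, d2, d3, d4⟩ := switch t G D f1 e1 g2 (by have := hdep g2 (hGs hg2); omega)
      (fun i hi => hgD g2 hg2 i (by omega))
      (fun u hu i hi h => huc g2 (hGs hg2) u hu i (by omega) h)
      (hgcopy g2 hg2 f1 (hne1 g2 (hGs hg2) hg12.symm)) w2 hw2'
      (by rw [hne1 g2 (hGs hg2) hg12.symm 10 (by norm_num)]; exact b1)
      (by rw [hne1 g2 (hGs hg2) hg12.symm 6 (by norm_num)]; exact b2)
    rw [hne1 g2 (hGs hg2) hg12.symm 1 (by norm_num)] at d3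
    have hne2 : ∀ z ∈ Y0, z ≠ g1 → z ≠ g2 → ∀ i < 13, f2 (t.par^[i] z) = f (t.par^[i] z) := by
      intro z hz hzg hzg2 i hi
      rw [← hne1 z hz hzg i hi]
      apply d2
      intro j _ hj h
      exact hzg2 (hun z hz g2 (hGs hg2) i hi j (by omega) h).1
    set z1 := f (t.par^[1] g1) with hz1d
    set z2 := f (t.par^[1] g2) with hz2d
    have hz1f : z1 ∉ D.image f2 := by
      intro h
      rcases mem_insert.1 (d4 h) with h | h
      · exact hw2 (h ▸ mem_image_of_mem f (hgD g1 hg1 1 (by norm_num)))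
      · exact e3 h
    have hvg : ∀ g ∈ Gs, v ≠ g := by
      rintro g hg rfl
      exact disjoint_left.1 hdis (mem_insert_self _ _) hg
    have hv3 : f2 (t.par^[3] v) = x := hne2 v hvY (hvg g1 hg1) (hvg g2 hg2) 3 (by norm_num)
    have hv0 : f2 v = y := hne2 v hvY (hvg g1 hg1) (hvg g2 hg2) 0 (by norm_num)
    -- put back the two postponed vertices
    have E1 := d1.update (t.par^[2] v) z1 (hvj 2 (by norm_num) (by norm_num)) hz1f
      (by
        intro _ _
        have : t.par (t.par^[2] v) = t.par^[3] v := rfl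
        rw [this, hv3]
        exact a3.symm)
      (by
        intro u hu hur hpu
        have := huc v hvY u hur 1 (by norm_num) hpu
        exact absurd (this ▸ hu) (hvj 1 (by norm_num) (by norm_num)))
    have hvne2 : v ≠ t.par^[2] v := by
      intro h
      have := (hun v hvY v hvY 0 (by norm_num) 2 (by norm_num) h).2
      omega
    have E2 := E1.update (t.par^[1] v) z2
      (by
        rw [mem_insert, not_or]
        exact ⟨hp12, hvj 1 (by norm_num) (by norm_num)⟩)
      (by
        intro h
        obtain ⟨u, hu, huz⟩ := mem_image.1 h
        rcases mem_insert.1 hu with h1 | h1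
        · rw [h1, Function.update_self] at huz
          exact hz12.ne huz
        · have hne : u ≠ t.par^[2] v := by
            rintro rfl
            exact hvj 2 (by norm_num) (by norm_num) h1
          rw [Function.update_of_ne hne] at huz
          exact d3 (huz ▸ mem_image_of_mem f2 h1))
      (by
        intro _ _
        have : t.par (t.par^[1] v) = t.par^[2] v := rfl
        rw [this, Function.update_self]
        exact hz12.symm)
      (by
        intro u _ hur hpu
        have := huc v hvY u hur 0 (by norm_num) hpu
        have huv : u = v := this
        rw [huv, Function.update_of_ne hvne2, hv0]
        exact b3)
    have hdelD : insert (t.par^[1] v) (insert (t.par^[2] v) D) = univ \ t.del Dl := by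
      ext u
      rw [mem_insert, mem_insert, hmemD, mem_sdiff, RT.mem_del]
      simp only [mem_univ, true_and]
      push Not
      constructor
      · rintro (rfl | rfl | h) y hy i h1 h3 heq
        · have := (hun y (hDl (mem_insert_of_mem hy)) v hvY i (by omega) 1 (by omega) heq).1
          exact hv (this ▸ hy)
        · have := (hun y (hDl (mem_insert_of_mem hy)) v hvY i (by omega) 2 (by omega) heq).1
          exact hv (this ▸ hy)
        · exact h y (mem_insert_of_mem hy) i h1 h3 heq
      · intro h
        by_cases hu1 : u = t.par^[1] v
        · exact Or.inl hu1
        by_cases hu2 : u = t.par^[2] v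
        · exact Or.inr (Or.inl hu2)
        right; right
        intro y hy i h1 h3 heq
        rcases mem_insert.1 hy with rfl | hy
        · have : i = 1 ∨ i = 2 := by omega
          rcases this with rfl | rfl
          · exact hu1 heq.symm
          · exact hu2 heq.symm
        · exact h y hy i h1 h3 heq
    rw [hdelD] at E2
    set f3 := Function.update (Function.update f2 (t.par^[2] v) z1) (t.par^[1] v) z2 with hf3
    have hf3c : ∀ g ∈ Gs, g ≠ g1 → g ≠ g2 → ∀ i < 13, f3 (t.par^[i] g) = f (t.par^[i] g) := by
      intro g hg hn1 hn2 i hi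
      have hk : ∀ j < 13, t.par^[i] g ≠ t.par^[j] v := by
        intro j hj h
        exact hvg g hg (hun g (hGs hg) v hvY i hi j hj h).1.symm
      rw [hf3, Function.update_of_ne (hk 1 (by norm_num)), Function.update_of_ne (hk 2 (by norm_num))]
      exact hne2 g (hGs hg) hn1 hn2 i hi
    refine ih ((Gs.erase g1).erase g2) f3 ((subset_insert _ _).trans hDl)
      (((erase_subset _ _).trans (erase_subset _ _)).trans hGs)
      ((hdis.mono_left (subset_insert _ _)).mono_right ((erase_subset _ _).trans (erase_subset _ _)))
      E2 ?_ ?_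
    · intro g hg
      rw [mem_erase, mem_erase] at hg
      exact hgcopy g hg.2.2 f3 (hf3c g hg.2.2 hg.2.1 hg.1)
    · intro w x
      have h1 := hcnt w x
      rw [card_insert_of_notMem hv] at h1
      have h2 : (((Gs.filter (fun g => GoodG G w x (fun i => f (t.par^[i] g)))).erase g1).erase g2) ⊆
          ((Gs.erase g1).erase g2).filter (fun g => GoodG G w x (fun i => f3 (t.par^[i] g))) := by
        intro g hg
        rw [mem_erase, mem_erase, mem_filter] at hg
        obtain ⟨k2, k1, kG, kg⟩ := hg
        refine mem_filter.2 ⟨mem_erase.2 ⟨k2, mem_erase.2 ⟨k1, kG⟩⟩, ?_⟩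
        have hh := hf3c g kG k1 k2
        obtain ⟨m1, m2, m3⟩ := kg
        refine ⟨?_, ?_, ?_⟩
        · simp only [hh 10 (by norm_num)]; exact m1
        · simp only [hh 6 (by norm_num)]; exact m2
        · simp only [hh 1 (by norm_num)]; exact m3
      have h3 := card_le_card h2
      have h4 := pred_card_le_card_erase
        (s := (Gs.filter (fun g => GoodG G w x (fun i => f (t.par^[i] g)))).erase g1) (a := g2)
      have h5 := pred_card_le_card_erase
        (s := Gs.filter (fun g => GoodG G w x (fun i => f (t.par^[i] g)))) (a := g1)
      omega

end ST

end

section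
open Finset
open scoped Classical

set_option linter.unusedSectionVars false
namespace ST
variable {U V : Type*} [Fintype U] [Fintype V]

lemma RT.frontier_card (t : RT U) {Δ : ℕ} (hΔ : ∀ v, (t.ch v).card ≤ Δ) (T1 : Finset U)
    (hcl : ∀ v ∈ T1, t.par v ∈ T1) :
    (univ.filter (fun v => v ∉ T1 ∧ v ≠ t.root ∧ t.par v ∈ T1)).card ≤ 1 + Δ * t.bad.card := by
  have h1 : ∑ v ∈ T1, (t.ch v).card ≤ T1.card + Δ * t.bad.card := by
    have : ∑ v ∈ T1, (t.ch v).card ≤ ∑ v ∈ T1, (1 + if v ∈ t.bad then Δ else 0) := by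
      apply sum_le_sum
      intro v _
      split_ifs with h
      · have := hΔ v; omega
      · simp only [RT.bad, mem_filter, mem_univ, true_and, not_not] at h
        omega
    refine this.trans ?_
    rw [sum_add_distrib, sum_const, smul_eq_mul, mul_one, ← sum_filter, sum_const, smul_eq_mul,
      mul_comm]
    apply Nat.add_le_add_left
    apply Nat.mul_le_mul_left
    apply card_le_card
    intro v hv
    exact (mem_filter.1 hv).2
  have h2 : (T1.biUnion t.ch).card = ∑ v ∈ T1, (t.ch v).card := by
    apply card_biUnion
    intro a _ b _ hab
    change Disjoint (t.ch a) (t.ch b)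
    rw [disjoint_left]
    intro u hu hu'
    exact hab ((RT.mem_ch.1 hu).2.symm.trans (RT.mem_ch.1 hu').2)
  have h3 : (T1.erase t.root) ∪ univ.filter (fun v => v ∉ T1 ∧ v ≠ t.root ∧ t.par v ∈ T1) ⊆
      T1.biUnion t.ch := by
    intro v hv
    rcases mem_union.1 hv with h | h
    · rw [mem_erase] at h
      exact mem_biUnion.2 ⟨_, hcl v h.2, RT.mem_ch.2 ⟨h.1, rfl⟩⟩
    · simp only [mem_filter, mem_univ, true_and] at h
      exact mem_biUnion.2 ⟨_, h.2.2, RT.mem_ch.2 ⟨h.2.1, rfl⟩⟩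
  have h4 := card_le_card h3
  rw [card_union_of_disjoint] at h4
  · have := pred_card_le_card_erase (s := T1) (a := t.root)
    omega
  · rw [disjoint_right]
    intro v hv hv'
    simp only [mem_filter, mem_univ, true_and] at hv
    exact hv.1 (mem_erase.1 hv').2

set_option maxHeartbeats 800000 in
theorem caseB [Nonempty V] (t : RT U) {Δ : ℕ} (hΔ : ∀ v, (t.ch v).card ≤ Δ) (hΔ1 : 0 < Δ)
    (G : SimpleGraph V) (hUV : Fintype.card U = Fintype.card V)
    (s d e d' e0 N h r1 dR1 r2 dR2 : ℕ) (hh : 0 < h)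
    (hJ : Joined G s) (hd : ∀ v, d ≤ (nb G v).card) (he : Fintype.card V ≤ e * d)
    (he0 : Fintype.card V ≤ e0 * d')
    (T1 Y0 Gs Dl : Finset U) (hcl : ∀ v ∈ T1, t.par v ∈ T1) (hY0 : Y0 ⊆ T1)
    (hdep : ∀ v ∈ Y0, 13 ≤ t.dep v)
    (hone : ∀ v ∈ Y0, ∀ i < 13, (t.ch (t.par^[i] v)).card = 1)
    (hch : ∀ x ∈ Y0, ∀ y ∈ Y0, ∀ i < 13, ∀ j < 13, t.par^[i] x = t.par^[j] y → x = y)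
    (hGs : Gs ⊆ Y0) (hDl : Dl ⊆ Y0) (hdis : Disjoint Dl Gs)
    (p1 : 11 * Gs.card + 11 + 2 * s ≤ d) (p2 : 11 * Gs.card + 3 * d' ≤ d)
    (p3 : 6 * e0 ^ 3 * N ≤ Gs.card) (p4 : Fintype.card V * Fintype.card V ≤ 2 ^ N)
    (p5 : 2 * (11 * Gs.card + r1) ≤ d) (p6 : 12 * e * dR1 ≤ r1)
    (p7 : 4 * T1.card + 2 * s ≤ dR1) (p8 : T1.card + r1 + 3 * s ≤ Fintype.card V)
    (p9 : 2 * (T1.card + r2) ≤ d) (p10 : 12 * e * dR2 ≤ r2) (p11 : Fintype.card V ≤ 2 ^ dR2)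
    (p12 : 2 * (2 + Fintype.card V / h + Δ * t.bad.card) + 2 * s ≤ dR2)
    (p13 : r2 + (h * Δ ^ h + 2) * s ≤ Dl.card) (p14 : 2 * Dl.card + 2 * s ≤ N) :
    ∃ F : U → V, Emb t G univ F := by
  have hun := t.chain_uniq 13 Y0 hdep hch
  have hnr : ∀ x ∈ Y0, ∀ i < 13, t.par^[i] x ≠ t.root := by
    intro x hx i hi
    apply t.ne_root_of_dep
    rw [t.dep_iter]
    have := hdep x hx
    omega
  have huc : ∀ v ∈ Y0, ∀ u, u ≠ t.root → ∀ i < 12, t.par u = t.par^[i + 1] v → u = t.par^[i] v := by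
    intro v hv u hu i hi h
    have h1 := hone v hv (i + 1) (by omega)
    obtain ⟨a, ha⟩ := card_eq_one.1 h1
    have m1 : u ∈ t.ch (t.par^[i + 1] v) := RT.mem_ch.2 ⟨hu, h⟩
    have m2 : t.par^[i] v ∈ t.ch (t.par^[i + 1] v) :=
      RT.mem_ch.2 ⟨hnr v hv i (by omega), (Function.iterate_succ_apply' t.par i v).symm⟩
    rw [ha, mem_singleton] at m1 m2
    rw [m1, m2]
  have hT1 : ∀ v ∈ T1, ∀ i, t.par^[i] v ∈ T1 := by
    intro v hv i
    induction i with
    | zero => exact hv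
    | succ i ih => rw [Function.iterate_succ_apply']; exact hcl _ ih
  have hGT : ∀ y ∈ Gs, ∀ i, t.par^[i] y ∈ T1 := fun y hy i => hT1 y (hY0 (hGs hy)) i
  have hGG : ∀ x ∈ Gs, ∀ y ∈ Gs, ∀ i < 13, ∀ j < 13, t.par^[i] x = t.par^[j] y → x = y ∧ i = j :=
    fun x hx y hy => hun x (hGs hx) y (hGs hy)
  have hGDel : ∀ y ∈ Gs, ∀ i < 13, t.par^[i] y ∉ t.del Dl := by
    intro y hy i hi hm
    obtain ⟨v, hv, j, h1, h3, hj⟩ := RT.mem_del.1 hm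
    have := (hun v (hDl hv) y (hGs hy) j (by omega) i hi hj).1
    subst this
    exact disjoint_left.1 hdis hv hy
  -- gadgets
  obtain ⟨τ, τ1, τ2, τ3⟩ := gadgets (L := U) G s d d' e0 N hJ hd he0 Gs p1 p2 p3 p4
  set Q := Gs.biUnion (fun y => (range 11).image (fun i => t.par^[i] y)) with hQ
  have hQm : ∀ u, u ∈ Q ↔ ∃ y ∈ Gs, ∃ i < 11, t.par^[i] y = u := by
    intro u
    simp only [hQ, mem_biUnion, mem_image, mem_range]
  have hf0 : ∀ u, ∃ x : V, ∀ y ∈ Gs, ∀ i < 11, t.par^[i] y = u → x = τ y i := by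
    intro u
    by_cases hu : u ∈ Q
    · obtain ⟨y, hy, i, hi, hyi⟩ := (hQm u).1 hu
      refine ⟨τ y i, ?_⟩
      intro y' hy' i' hi' h'
      have := hGG y hy y' hy' i (by omega) i' (by omega) (hyi.trans h'.symm)
      rw [this.1, this.2]
    · refine ⟨Classical.arbitrary V, ?_⟩
      intro y hy i hi h
      exact absurd ((hQm u).2 ⟨y, hy, i, hi, h⟩) hu
  choose f0 hf0 using hf0
  have hf0' : ∀ y ∈ Gs, ∀ i < 11, f0 (t.par^[i] y) = τ y i := fun y hy i hi => hf0 _ y hy i hi rfl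
  have hE0 : Emb t G Q f0 := by
    constructor
    · intro a ha b hb hab
      obtain ⟨y, hy, i, hi, rfl⟩ := (hQm a).1 ha
      obtain ⟨y', hy', i', hi', rfl⟩ := (hQm b).1 hb
      rw [hf0' y hy i hi, hf0' y' hy' i' hi'] at hab
      by_cases hyy : y = y'
      · subst hyy
        rw [(τ1 y hy).inj i hi i' hi' hab]
      · exact absurd hab (τ2 y hy y' hy' hyy i hi i' hi')
    · intro u hu hur hpu
      obtain ⟨y, hy, i, hi, rfl⟩ := (hQm u).1 hu
      rw [← Function.iterate_succ_apply' (f := t.par)] at hpu ⊢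
      obtain ⟨y', hy', i', hi', h'⟩ := (hQm _).1 hpu
      have h2 := hGG y' hy' y hy i' (by omega) (i + 1) (by omega) h'
      rw [hf0' y hy i hi, hf0' y hy (i + 1) (by omega)]
      exact (τ1 y hy).path i (by omega)
  have hQc : Q.card ≤ 11 * Gs.card := by
    rw [mul_comm]
    refine card_biUnion_le_card_mul _ _ _ (fun y _ => ?_)
    exact card_image_le.trans (by simp)
  have hQi : (Q.image f0).card ≤ 11 * Gs.card := card_image_le.trans hQc
  have hdR2 : dR2 ≤ dR1 := by
    have hT : Gs.card ≤ T1.card := card_le_card (hGs.trans hY0)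
    have hD : Dl.card ≤ T1.card := card_le_card (hDl.trans hY0)
    have : dR2 ≤ r2 ∨ e = 0 := by
      rcases Nat.eq_zero_or_pos e with h | h
      · exact Or.inr h
      · left; nlinarith
    rcases this with h | h
    · omega
    · subst h
      have := Fintype.card_pos (α := V)
      omega
  obtain ⟨R1, hR1c, hR1d, hR1n⟩ := reserve G d e dR1 r1 hd he (Q.image f0) (by omega) p6
    (p11.trans (Nat.pow_le_pow_right (by norm_num) hdR2))
  -- phase 1
  set c2 : U → U := fun y => t.par^[11] y with hc2
  set c1 : U → U := fun y => t.par^[12] y with hc1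
  set D1 := T1 \ t.del Dl with hD1
  set C0 := D1 \ (Q ∪ (Gs.image c1 ∪ Gs.image c2)) with hC0
  have hDeq : D1 = Q ∪ (Gs.image c1 ∪ Gs.image c2) ∪ C0.biUnion (fun c => {c}) := by
    rw [biUnion_singleton_eq_self, hC0, union_sdiff_of_subset]
    intro u hu
    rcases mem_union.1 hu with hu | hu
    · obtain ⟨y, hy, i, hi, rfl⟩ := (hQm u).1 hu
      exact mem_sdiff.2 ⟨hGT y hy i, hGDel y hy i (by omega)⟩
    · rcases mem_union.1 hu with hu | hu
      · obtain ⟨y, hy, rfl⟩ := mem_image.1 hu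
        exact mem_sdiff.2 ⟨hGT y hy 12, hGDel y hy 12 (by omega)⟩
      · obtain ⟨y, hy, rfl⟩ := mem_image.1 hu
        exact mem_sdiff.2 ⟨hGT y hy 11, hGDel y hy 11 (by omega)⟩
  have hC0Q : ∀ c ∈ C0, c ∉ Q ∧ (∀ y ∈ Gs, c ≠ c1 y) ∧ ∀ y ∈ Gs, c ≠ c2 y := by
    intro c hc
    have h1 := (mem_sdiff.1 hc).2
    simp only [mem_union, not_or, mem_image, not_exists, not_and] at h1
    exact ⟨h1.1, fun y hy h => h1.2.1 y hy h.symm, fun y hy h => h1.2.2 y hy h.symm⟩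
  have hD1c : D1.card ≤ T1.card := card_le_card sdiff_subset
  have hC0c : C0.card ≤ T1.card := (card_le_card sdiff_subset).trans hD1c
  have hGc : Gs.card ≤ T1.card := card_le_card (hGs.trans hY0)
  obtain ⟨f1, g1, g2, -⟩ := embed_mix t G s 1 dR1 hJ R1 hR1n Q f0 hE0 hR1d Gs
    (fun y => t.par^[10] y) c2 c1
    (by
      intro y hy
      refine ⟨(hQm _).2 ⟨y, hy, 10, by norm_num, rfl⟩, rfl, rfl, hnr y (hGs hy) 11 (by norm_num), ?_, ?_⟩
      · intro hm
        obtain ⟨y', hy', i, hi, h⟩ := (hQm _).1 hm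
        have := (hGG y' hy' y hy i (by omega) 12 (by norm_num) h).2
        omega
      · intro hm
        obtain ⟨y', hy', i, hi, h⟩ := (hQm _).1 hm
        have := (hGG y' hy' y hy i (by omega) 11 (by norm_num) h).2
        omega)
    (fun y hy y' hy' h => (hGG y hy y' hy' 12 (by norm_num) 12 (by norm_num) h).1)
    (fun y hy y' hy' h => (hGG y hy y' hy' 11 (by norm_num) 11 (by norm_num) h).1)
    (fun y hy y' hy' h => by
      have := (hGG y hy y' hy' 12 (by norm_num) 11 (by norm_num) h).2
      omega)
    (by
      intro v hv hvr y hy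
      obtain ⟨y', hy', i, hi, rfl⟩ := (hQm v).1 hv
      rw [← Function.iterate_succ_apply' (f := t.par)]
      constructor
      · intro h
        have := hGG y' hy' y hy (i + 1) (by omega) 11 (by norm_num) h
        obtain ⟨rfl, h2⟩ := this
        have : i = 10 := by omega
        rw [this]
      · intro h
        have := (hGG y' hy' y hy (i + 1) (by omega) 12 (by norm_num) h).2
        omega)
    (fun c => {c}) C0
    (by
      intro c hc
      rw [disjoint_singleton_left]
      exact (hC0Q c hc).1)
    (by
      intro c hc y hy
      simp only [mem_singleton]
      exact ⟨fun h => (hC0Q c hc).2.1 y hy h.symm, fun h => (hC0Q c hc).2.2 y hy h.symm⟩)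
    (by
      intro c _ c' _ hcc
      rw [disjoint_singleton]
      exact hcc)
    (by
      intro c _
      refine ⟨mem_singleton_self _, ?_⟩
      intro v hv
      rw [mem_singleton] at hv
      subst hv
      exact ⟨le_rfl, fun h => absurd rfl h⟩)
    (by intro c _; simp)
    (by
      intro c hc v hv hvr hm
      rw [mem_singleton] at hm
      obtain ⟨y, hy, i, hi, rfl⟩ := (hQm v).1 hv
      rw [← Function.iterate_succ_apply' (f := t.par)] at hm
      by_cases hi' : i < 10
      · exact (hC0Q c hc).1 ((hQm c).2 ⟨y, hy, i + 1, by omega, hm⟩)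
      · have : i = 10 := by omega
        subst this
        exact (hC0Q c hc).2.2 y hy hm.symm)
    (by omega) D1 hDeq (by omega)
  -- phase 2
  have hD1i : (D1.image f1).card ≤ T1.card := card_image_le.trans hD1c
  obtain ⟨R2, hR2c, hR2d, hR2n⟩ := reserve G d e dR2 r2 hd he (D1.image f1) (by omega) p10 p11
  obtain ⟨r0, hr0, hcuts⟩ := t.cuts_card T1 h hh
  obtain ⟨blk, k1, k2, k3, k4, k5⟩ := t.blocks hΔ hΔ1 T1 h r0 hr0
  have hfr := t.frontier_card hΔ T1 hcl
  rw [hUV] at hcuts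
  have hdelT : t.del Dl ⊆ T1 := by
    intro u hu
    obtain ⟨v, hv, j, -, -, rfl⟩ := RT.mem_del.1 hu
    exact hT1 v (hY0 (hDl hv)) j
  have hDD : D1 ∪ (t.cuts T1 h r0).biUnion blk = univ \ t.del Dl := by
    rw [k5]
    ext u
    simp only [hD1, mem_union, mem_sdiff, mem_univ, true_and]
    constructor
    · rintro (h | h)
      · exact h.2
      · exact fun h' => h (hdelT h')
    · intro h
      by_cases hu : u ∈ T1
      · exact Or.inl ⟨hu, h⟩
      · exact Or.inr hu
  have hdelc : Dl.card ≤ (t.del Dl).card := by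
    have : (Dl.image (fun v => t.par^[1] v)).card = Dl.card := by
      apply card_image_of_injOn
      intro a ha b hb hab
      exact hch a (hDl ha) b (hDl hb) 1 (by norm_num) 1 (by norm_num) hab
    rw [← this]
    exact card_le_card subset_union_left
  obtain ⟨f2, q1, q2, -⟩ := embed_cuts t G s (h * Δ ^ h) dR2 hJ R2 hR2n D1 f1 g2 hR2d blk
    (t.cuts T1 h r0) (fun c hc => (k1 c hc).mono_right sdiff_subset) k2 k3
    (by
      intro c hc
      left
      refine ⟨k4 c hc, ?_⟩
      intro v hv _ hm
      exact disjoint_left.1 (k1 c hc) hm (hcl v (mem_sdiff.1 hv).1))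
    (by omega) (by
      rw [hDD]
      have := card_sdiff_add_card_eq_card (subset_univ (t.del Dl))
      rw [card_univ] at this
      omega)
  rw [hDD] at q2
  have hf2 : ∀ y ∈ Gs, ∀ i < 11, f2 (t.par^[i] y) = τ y i := by
    intro y hy i hi
    have hm : t.par^[i] y ∈ Q := (hQm _).2 ⟨y, hy, i, hi, rfl⟩
    rw [q1 _ (mem_sdiff.2 ⟨hGT y hy i, hGDel y hy i (by omega)⟩), g1 _ hm, hf0' y hy i hi]
  refine finishB t G s hJ hUV Y0 hdep hun huc Dl Gs f2 hDl hGs hdis q2 ?_ ?_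
  · intro y hy
    have h0 := τ1 y hy
    refine ⟨?_, ?_, ?_, ?_⟩
    · intro i hi j hj hij
      simp only [hf2 y hy i hi, hf2 y hy j hj] at hij
      exact h0.inj i hi j hj hij
    · intro i hi
      simp only [hf2 y hy i (by omega), hf2 y hy (i + 1) (by omega)]
      exact h0.path i hi
    · simp only [hf2 y hy 2 (by omega), hf2 y hy 0 (by omega)]
      exact h0.a20
    · simp only [hf2 y hy 9 (by omega), hf2 y hy 5 (by omega)]
      exact h0.a95
  · intro w x
    refine (p14.trans (τ3 w x)).trans (card_le_card ?_)
    intro y hy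
    obtain ⟨hy, m1, m2, m3⟩ := mem_filter.1 hy
    refine mem_filter.2 ⟨hy, ?_, ?_, ?_⟩
    · simp only [hf2 y hy 10 (by omega)]; exact m1
    · simp only [hf2 y hy 6 (by omega)]; exact m2
    · simp only [hf2 y hy 1 (by omega)]; exact m3

end ST

end

section
open Finset
open scoped Classical

set_option linter.unusedSectionVars false
namespace ST
variable {U V : Type*} [Fintype U] [Fintype V]

lemma RT.exists_closed (t : RT U) (m : ℕ) (hm : m ≤ Fintype.card U) (hm0 : 0 < m) :
    ∃ T1 : Finset U, (∀ v ∈ T1, t.par v ∈ T1) ∧ T1.card = m := by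
  induction m with
  | zero => omega
  | succ m ih =>
    rcases Nat.eq_zero_or_pos m with rfl | hpos
    · exact ⟨{t.root}, by simp [t.par_root], by simp⟩
    obtain ⟨T, hT, hc⟩ := ih (by omega) hpos
    have hne : (univ \ T).Nonempty := by
      rw [← card_pos, card_sdiff_of_subset (subset_univ _), card_univ]; omega
    obtain ⟨v, hv, hmin⟩ := exists_min_image (univ \ T) t.dep hne
    rw [mem_sdiff] at hv
    refine ⟨insert v T, ?_, by rw [card_insert_of_notMem hv.2, hc]⟩
    intro u hu
    rcases mem_insert.1 hu with rfl | h
    · by_cases hr : u = t.root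
      · rw [hr, t.par_root]; exact mem_insert_self _ _
      · apply mem_insert_of_mem
        by_contra hp
        have := hmin (t.par u) (mem_sdiff.2 ⟨mem_univ _, hp⟩)
        have := t.dep_par u hr
        omega
    · exact mem_insert_of_mem (hT u h)

lemma RT.selA (t : RT U) {Δ : ℕ} (hΔ : ∀ v, (t.ch v).card ≤ Δ) (hΔ1 : 0 < Δ) (x : ℕ)
    (hx : 4 * Δ ^ 4 + 4 * (4 * Δ ^ 4) * x ≤ t.leaves.card) :
    ∃ L0 : Finset U, (∀ v ∈ L0, (t.ch v).card = 0) ∧ (∀ v ∈ L0, 4 ≤ t.dep v) ∧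
      (∀ x ∈ L0, ∀ y ∈ L0, ∀ i < 4, ∀ j < 4, t.par^[i] x = t.par^[j] y → x = y) ∧
      x ≤ L0.card := by
  have hsub : t.leaves ⊆ t.leaves.filter (fun v => 4 ≤ t.dep v) ∪
      univ.filter (fun v => t.dep v < 4) := by
    intro v hv
    simp only [mem_union, mem_filter, mem_univ, true_and]
    by_cases h : 4 ≤ t.dep v
    · exact Or.inl ⟨hv, h⟩
    · right; omega
  have h1 := (card_le_card hsub).trans (card_union_le _ _)
  have h2 := t.shallow_card hΔ hΔ1 4
  obtain ⟨Y, hY, hc, hcard⟩ := t.chains hΔ hΔ1 4 (by norm_num)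
    (t.leaves.filter (fun v => 4 ≤ t.dep v)) (fun v hv => (mem_filter.1 hv).2)
  refine ⟨Y, ?_, fun v hv => (mem_filter.1 (hY hv)).2, hc, ?_⟩
  · intro v hv
    have := (mem_filter.1 (hY hv)).1
    simp only [RT.leaves, mem_filter, mem_univ, true_and] at this
    exact this
  · have h3 : 4 * (4 * Δ ^ 4) * x ≤ 4 * (4 * Δ ^ 4) * Y.card := by omega
    exact Nat.le_of_mul_le_mul_left h3 (by positivity)

lemma RT.selB (t : RT U) {Δ : ℕ} (hΔ : ∀ v, (t.ch v).card ≤ Δ) (hΔ1 : 0 < Δ) (x : ℕ)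
    (T1 : Finset U)
    (hx : 13 * Δ ^ 13 + 13 * (t.bad.card * Δ ^ 13) + 13 * (13 * Δ ^ 13) * x ≤ T1.card) :
    ∃ Y0 ⊆ T1, (∀ v ∈ Y0, 13 ≤ t.dep v) ∧
      (∀ v ∈ Y0, ∀ i < 13, (t.ch (t.par^[i] v)).card = 1) ∧
      (∀ x ∈ Y0, ∀ y ∈ Y0, ∀ i < 13, ∀ j < 13, t.par^[i] x = t.par^[j] y → x = y) ∧
      x ≤ Y0.card := by
  set B := (range 13).biUnion (fun i => t.bad.biUnion (fun u =>
    univ.filter (fun v => i ≤ t.dep v ∧ t.par^[i] v = u))) with hB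
  have hBc : B.card ≤ 13 * (t.bad.card * Δ ^ 13) := by
    refine (card_biUnion_le_card_mul _ _ (t.bad.card * Δ ^ 13) ?_).trans (by simp)
    intro i hi
    refine card_biUnion_le_card_mul _ _ (Δ ^ 13) ?_
    intro u _
    exact (t.desc_card hΔ i u).trans (Nat.pow_le_pow_right hΔ1 (mem_range.1 hi).le)
  set S := (T1 \ univ.filter (fun v => t.dep v < 13)) \ B with hS
  have hSc : T1.card ≤ S.card + 13 * Δ ^ 13 + 13 * (t.bad.card * Δ ^ 13) := by
    have h1 := t.shallow_card hΔ hΔ1 13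
    have h2 := le_card_sdiff B (T1 \ univ.filter (fun v => t.dep v < 13))
    change _ ≤ S.card at h2
    have h3 := le_card_sdiff (univ.filter (fun v => t.dep v < 13)) T1
    omega
  have hS13 : ∀ v ∈ S, 13 ≤ t.dep v := by
    intro v hv
    have := (mem_sdiff.1 (mem_sdiff.1 hv).1).2
    simp only [mem_filter, mem_univ, true_and] at this
    omega
  obtain ⟨Y, hY, hc, hcard⟩ := t.chains hΔ hΔ1 13 (by norm_num) S hS13
  refine ⟨Y, fun v hv => (mem_sdiff.1 (mem_sdiff.1 (hY hv)).1).1, fun v hv => hS13 v (hY hv),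
    ?_, hc, ?_⟩
  · intro v hv i hi
    have h1 := (mem_sdiff.1 (hY hv)).2
    by_contra hne
    apply h1
    rw [hB, mem_biUnion]
    refine ⟨i, mem_range.2 hi, mem_biUnion.2 ⟨t.par^[i] v, ?_, ?_⟩⟩
    · simp only [RT.bad, mem_filter, mem_univ, true_and]
      exact hne
    · simp only [mem_filter, mem_univ, true_and, and_true]
      have := hS13 v (hY hv)
      omega
  · have h3 : 13 * (13 * Δ ^ 13) * x ≤ 13 * (13 * Δ ^ 13) * Y.card := by omega
    exact Nat.le_of_mul_le_mul_left h3 (by positivity)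

end ST

end

section
open Finset
open scoped Classical

set_option linter.unusedSectionVars false
namespace ST
variable {U V : Type*} [Fintype U] [Fintype V]

set_option maxHeartbeats 1000000 in
/-- The two cases combined, with all the quantities multiples of a unit `w`. -/
theorem core [Nonempty V] (t : RT U) {Δ : ℕ} (hΔ : ∀ v, (t.ch v).card ≤ Δ) (hΔ1 : 0 < Δ)
    (G : SimpleGraph V) (hUV : Fintype.card U = Fintype.card V)
    (s w e h cR cr lam cR2 cr2 cD cN cG tau cR1 cr1 D : ℕ) (hh : 0 < h) (hw : 0 < w)
    (hsw : (h * Δ ^ h + 2 + 12 * e) * s ≤ w) (hpow : Fintype.card V ≤ 2 ^ s)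
    (hnh : Fintype.card V / h ≤ w) (hJ : Joined G s) (he1 : 0 < e)
    (hd : ∀ v, 4 * D * w ≤ (nb G v).card) (he : Fintype.card V ≤ e * (4 * D * w))
    (hDn : 4 * D * w ≤ Fintype.card V)
    (hcR : cR = 2 * (3 * Δ + 1) + 6) (hcr : cr = 12 * e * cR)
    (hlam : lam = 4 * Δ ^ 4 + 4 * (4 * Δ ^ 4) * (cr + 1))
    (hcR2 : cR2 = 4 * Δ * lam + 8) (hcr2 : cr2 = 12 * e * cR2) (hcD : cD = cr2 + 1)
    (hcN : cN = 2 * cD + 2) (hcG : cG = 6 * (4 * e) ^ 3 * cN)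
    (htau : tau = 13 * Δ ^ 13 + 13 * (2 * lam * Δ ^ 13) + 13 * (13 * Δ ^ 13) * (cG + cD))
    (hcR1 : cR1 = 4 * tau + 2) (hcr1 : cr1 = 12 * e * cR1)
    (hD : D = 11 * cG + cr1 + tau + cr2 + cr + 20) :
    ∃ F, Emb t G univ F := by
  have hs1 : (h * Δ ^ h + 2) * s ≤ w := (Nat.mul_le_mul_right s (by omega)).trans hsw
  have hs2 : 12 * e * s ≤ w := (Nat.mul_le_mul_right s (by omega)).trans hsw
  have hs12 : 12 * s ≤ w := (Nat.mul_le_mul_right s (by omega)).trans hsw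
  have hs3 : 2 * s ≤ w := by omega
  have hDw : D * w = 11 * (cG * w) + cr1 * w + tau * w + cr2 * w + cr * w + 20 * w := by
    rw [hD]; ring
  have h4D : 4 * D * w = 4 * (D * w) := by ring
  by_cases hl : lam * w ≤ t.leaves.card
  · obtain ⟨L0, hleaf, hdep, hch, hc⟩ := t.selA hΔ hΔ1 ((cr + 1) * w) (by
      refine le_trans ?_ hl
      rw [hlam, add_mul (4 * Δ ^ 4)]
      apply Nat.add_le_add
      · exact Nat.le_mul_of_pos_right _ hw
      · exact le_of_eq (by ring))
    obtain ⟨Ls, hLs, hLc⟩ := exists_subset_card_eq (s := L0) (n := w) (by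
      refine le_trans ?_ hc
      exact Nat.le_mul_of_pos_left _ (by omega))
    have hc' : (cr + 1) * w = cr * w + w := by ring
    refine caseA t hΔ hΔ1 G hUV s (4 * D * w) e h (cr * w) (cR * w) hh hJ hd he L0 Ls hleaf hdep
      hch hLs ?_ ?_ ?_ hpow ?_ ?_
    · rw [hLc]; exact hs2
    · rw [hLc]; omega
    · rw [hcr]; exact le_of_eq (by ring)
    · rw [hLc]
      have : cR * w = 2 * ((3 * Δ + 1) * w) + 6 * w := by rw [hcR]; ring
      omega
    · omega
  · push Not at hl
    have hbad : t.bad.card ≤ 2 * (lam * w) := by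
      have := t.bad_card
      omega
    obtain ⟨T1, hcl, hT1⟩ := t.exists_closed (tau * w) (by omega) (by
      have : 0 < Δ ^ 13 := by positivity
      apply Nat.mul_pos _ hw
      omega)
    obtain ⟨Y0, hY0, hdep, hone, hch, hc⟩ := t.selB hΔ hΔ1 ((cG + cD) * w) T1 (by
      rw [hT1]
      have h1 : tau * w = 13 * Δ ^ 13 * w + 13 * (2 * (lam * w) * Δ ^ 13) +
        13 * (13 * Δ ^ 13) * ((cG + cD) * w) := by rw [htau]; ring
      rw [h1]
      refine Nat.add_le_add_right (Nat.add_le_add (Nat.le_mul_of_pos_right _ hw) ?_) _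
      exact Nat.mul_le_mul_left _ (Nat.mul_le_mul_right _ hbad))
    have hc' : (cG + cD) * w = cG * w + cD * w := by ring
    obtain ⟨Gs, hGs, hGc⟩ := exists_subset_card_eq (s := Y0) (n := cG * w) (by omega)
    obtain ⟨Dl, hDl, hDc⟩ := exists_subset_card_eq (s := Y0 \ Gs) (n := cD * w) (by
      rw [card_sdiff_of_subset hGs]; omega)
    have hNw : cN * w = 2 * (cD * w) + 2 * w := by rw [hcN]; ring
    have hR1w : cR1 * w = 4 * (tau * w) + 2 * w := by rw [hcR1]; ring
    have hDlw : cD * w = cr2 * w + w := by rw [hcD]; ring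
    have hR2w : cR2 * w = 2 * (Δ * (2 * (lam * w))) + 8 * w := by rw [hcR2]; ring
    have hΔb : Δ * t.bad.card ≤ Δ * (2 * (lam * w)) := Nat.mul_le_mul_left _ hbad
    refine caseB t hΔ hΔ1 G hUV s (4 * D * w) e (D * w) (4 * e) (cN * w) h (cr1 * w) (cR1 * w)
      (cr2 * w) (cR2 * w) hh hJ hd he (he.trans (le_of_eq (by ring))) T1 Y0 Gs Dl hcl hY0 hdep hone
      hch hGs (hDl.trans sdiff_subset) (disjoint_of_subset_left hDl sdiff_disjoint)
      ?_ ?_ ?_ ?_ ?_ ?_ ?_ ?_ ?_ ?_ ?_ ?_ ?_ ?_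
    · omega
    · omega
    · rw [hGc, hcG]; exact le_of_eq (by ring)
    · calc Fintype.card V * Fintype.card V ≤ 2 ^ s * 2 ^ s := Nat.mul_le_mul hpow hpow
        _ = 2 ^ (s + s) := (pow_add _ _ _).symm
        _ ≤ 2 ^ (cN * w) := Nat.pow_le_pow_right (by norm_num) (by omega)
    · omega
    · rw [hcr1]; exact le_of_eq (by ring)
    · omega
    · omega
    · omega
    · rw [hcr2]; exact le_of_eq (by ring)
    · exact hpow.trans (Nat.pow_le_pow_right (by norm_num) (by omega))
    · omega
    · rw [hDc]; omega
    · omega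

theorem sq_le_two_pow (s : ℕ) (hs : 4 ≤ s) : s * s ≤ 2 ^ s := by
  induction s, hs using Nat.le_induction with
  | base => norm_num
  | succ n hn ih => rw [pow_succ]; nlinarith

theorem main_aux (ε : ℝ) (hε : 0 < ε) (Δ : ℕ) (hΔ : 0 < Δ) :
    ∃ α : ℝ, 0 < α ∧ ∃ n₀ : ℕ, ∀ n : ℕ, n₀ ≤ n →
      ∀ G : SimpleGraph (Fin n),
        (∀ v, ε * n ≤ ((G.neighborSet v).ncard : ℝ)) →
        (∀ S T : Finset (Fin n), Disjoint S T → S.card = T.card →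
          α * n ≤ (S.card : ℝ) → ∃ s ∈ S, ∃ t ∈ T, G.Adj s t) →
        ∀ T : SimpleGraph (Fin n), T.IsTree →
          (∀ v, (T.neighborSet v).ncard ≤ Δ) →
          ∃ f : Fin n → Fin n, Function.Injective f ∧
            ∀ u v, T.Adj u v → G.Adj (f u) (f v) := by
  obtain ⟨e1, he1⟩ := exists_nat_gt (1 / ε)
  have he1pos : (0 : ℝ) < e1 := lt_trans (by positivity) he1
  have he1N : 0 < e1 := by exact_mod_cast he1pos
  have hε1 : 1 ≤ ε * e1 := by
    rw [div_lt_iff₀ hε] at he1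
    nlinarith
  obtain ⟨e, he⟩ : ∃ e, e = e1 + 1 := ⟨_, rfl⟩
  obtain ⟨cR, hcR⟩ : ∃ x, x = 2 * (3 * Δ + 1) + 6 := ⟨_, rfl⟩
  obtain ⟨cr, hcr⟩ : ∃ x, x = 12 * e * cR := ⟨_, rfl⟩
  obtain ⟨lam, hlam⟩ : ∃ x, x = 4 * Δ ^ 4 + 4 * (4 * Δ ^ 4) * (cr + 1) := ⟨_, rfl⟩
  obtain ⟨cR2, hcR2⟩ : ∃ x, x = 4 * Δ * lam + 8 := ⟨_, rfl⟩
  obtain ⟨cr2, hcr2⟩ : ∃ x, x = 12 * e * cR2 := ⟨_, rfl⟩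
  obtain ⟨cD, hcD⟩ : ∃ x, x = cr2 + 1 := ⟨_, rfl⟩
  obtain ⟨cN, hcN⟩ : ∃ x, x = 2 * cD + 2 := ⟨_, rfl⟩
  obtain ⟨cG, hcG⟩ : ∃ x, x = 6 * (4 * e) ^ 3 * cN := ⟨_, rfl⟩
  obtain ⟨tau, htau⟩ : ∃ x, x = 13 * Δ ^ 13 + 13 * (2 * lam * Δ ^ 13) +
    13 * (13 * Δ ^ 13) * (cG + cD) := ⟨_, rfl⟩
  obtain ⟨cR1, hcR1⟩ : ∃ x, x = 4 * tau + 2 := ⟨_, rfl⟩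
  obtain ⟨cr1, hcr1⟩ : ∃ x, x = 12 * e * cR1 := ⟨_, rfl⟩
  obtain ⟨D, hD⟩ : ∃ x, x = 11 * cG + cr1 + tau + cr2 + cr + 20 := ⟨_, rfl⟩
  obtain ⟨C, hC⟩ : ∃ C, C = e1 * (4 * D) := ⟨_, rfl⟩
  obtain ⟨K, hK⟩ : ∃ K, K = (C + 1) * Δ ^ (C + 1) + 2 + 12 * e := ⟨_, rfl⟩
  obtain ⟨M, hM⟩ : ∃ M, M = (C + 1) * (2 * K) := ⟨_, rfl⟩
  have hKpos : 0 < K := by omega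
  have hCpos : 0 < C := by rw [hC]; apply Nat.mul_pos he1N; omega
  have hMpos : 0 < M := by rw [hM]; positivity
  refine ⟨1 / M, by positivity, C * (C + K * (M + 4)), ?_⟩
  intro n hn G hdeg hhole T hT hTΔ
  -- the unit
  obtain ⟨w, hw⟩ : ∃ w, w = n / C := ⟨_, rfl⟩
  have hwbig : C + K * (M + 4) ≤ w := by
    rw [hw, Nat.le_div_iff_mul_le hCpos]; linarith
  have hCw : C * w ≤ n := by rw [hw]; exact Nat.mul_div_le n C
  have hnw : n ≤ (C + 1) * w := by
    have h1 := Nat.div_add_mod n C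
    have h2 := Nat.mod_lt n hCpos
    rw [← hw] at h1
    have : (C + 1) * w = C * w + w := by ring
    omega
  obtain ⟨s, hs⟩ : ∃ s, s = w / K := ⟨_, rfl⟩
  have hsbig : M + 4 ≤ s := by
    rw [hs, Nat.le_div_iff_mul_le hKpos]
    have : K * (M + 4) = (M + 4) * K := mul_comm _ _
    omega
  have hKs : K * s ≤ w := by rw [hs]; exact Nat.mul_div_le w K
  have hws : w ≤ 2 * K * s := by
    have h1 := Nat.div_add_mod w K
    have h2 := Nat.mod_lt w hKpos
    rw [← hs] at h1
    have : K * 1 ≤ K * s := Nat.mul_le_mul_left _ (by omega)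
    have : 2 * K * s = K * s + K * s := by ring
    omega
  have hnM : n ≤ M * s := by
    calc n ≤ (C + 1) * w := hnw
      _ ≤ (C + 1) * (2 * K * s) := Nat.mul_le_mul_left _ hws
      _ = M * s := by rw [hM]; ring
  have hpow : n ≤ 2 ^ s := by
    refine hnM.trans (le_trans ?_ (sq_le_two_pow s (by omega)))
    exact Nat.mul_le_mul_right _ (by omega)
  have hwpos : 0 < w := by omega
  have hnpos : 0 < n := lt_of_lt_of_le (Nat.mul_pos hCpos hwpos) hCw
  have : Nonempty (Fin n) := ⟨⟨0, hnpos⟩⟩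
  have hJ : Joined G s := by
    intro S S' hdis h1 h2
    obtain ⟨A, hA, hAc⟩ := exists_subset_card_eq h1
    obtain ⟨B, hB, hBc⟩ := exists_subset_card_eq h2
    obtain ⟨a, ha, b, hb, hab⟩ := hhole A B (disjoint_of_subset_left hA
      (disjoint_of_subset_right hB hdis)) (by omega) (by
        rw [hAc, one_div, inv_mul_le_iff₀ (by exact_mod_cast hMpos)]
        exact_mod_cast hnM)
    exact ⟨a, hA ha, b, hB hb, hab⟩
  have hnb : ∀ (H : SimpleGraph (Fin n)) v, (H.neighborSet v).ncard = (nb H v).card := by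
    intro H v
    rw [← Set.ncard_coe_finset]
    congr 1
    ext u
    simp [mem_nb]
  have h4D : 4 * D * w ≤ n := by
    refine le_trans ?_ hCw
    rw [hC]
    exact Nat.mul_le_mul_right _ (Nat.le_mul_of_pos_left _ he1N)
  have hdeg' : ∀ v, 4 * D * w ≤ (nb G v).card := by
    intro v
    have h1 := hdeg v
    rw [hnb] at h1
    have h2 : (e1 : ℝ) * (4 * D * w) ≤ n := by
      have : e1 * (4 * D * w) ≤ n := by rw [← mul_assoc, ← hC]; exact hCw
      exact_mod_cast this
    have h3 : ((4 * D * w : ℕ) : ℝ) ≤ ε * n := by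
      push_cast
      have h5 : (0 : ℝ) ≤ 4 * D * w := by positivity
      calc (4 * D * w : ℝ) ≤ (ε * e1) * (4 * D * w) := le_mul_of_one_le_left h5 hε1
        _ = ε * (e1 * (4 * D * w)) := by ring
        _ ≤ ε * n := mul_le_mul_of_nonneg_left h2 hε.le
    exact_mod_cast h3.trans h1
  obtain ⟨t, ht1, ht2⟩ := exists_RT T hT
  have hch : ∀ v, (t.ch v).card ≤ Δ := by
    intro v
    refine le_trans (card_le_card ?_) ((hnb T v).symm.le.trans (hTΔ v))
    intro u hu
    rw [RT.mem_ch] at hu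
    rw [mem_nb]
    have := ht1 u hu.1
    rw [hu.2] at this
    exact this.symm
  obtain ⟨F, hF1, hF2⟩ := core t hch hΔ G rfl s w e (C + 1) cR cr lam cR2 cr2 cD cN cG tau cR1 cr1
    D (by omega) hwpos (by rw [← hK]; exact hKs) (by rw [Fintype.card_fin]; exact hpow)
    (by rw [Fintype.card_fin]; exact Nat.div_le_of_le_mul hnw) hJ (by omega) hdeg'
    (by
      rw [Fintype.card_fin]
      refine hnw.trans ?_
      rw [hC, he]
      have h6 : (e1 + 1) * (4 * D * w) = (e1 * (4 * D)) * w + 4 * D * w := by ring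
      have h7 : (e1 * (4 * D) + 1) * w = (e1 * (4 * D)) * w + w := by ring
      rw [h6, h7]
      apply Nat.add_le_add_left
      exact Nat.le_mul_of_pos_left _ (by omega))
    (by rw [Fintype.card_fin]; exact h4D)
    hcR hcr hlam hcR2 hcr2 hcD hcN hcG htau hcR1 hcr1 hD
  refine ⟨F, fun a b hab => hF1 (by simp) (by simp) hab, ?_⟩
  intro u v huv
  rcases ht2 u v huv with ⟨h1, h2⟩ | ⟨h1, h2⟩
  · have := hF2 u (mem_univ _) h1 (mem_univ _)
    rwa [h2] at this
  · have := hF2 v (mem_univ _) h1 (mem_univ _)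
    rw [h2] at this
    exact this.symm

end ST

end

end

/-- **Theorem 1.** For every `ε > 0` and positive integer `Δ`, there exists `α > 0` such that
for all sufficiently large `n`: every `n`-vertex graph `G` with minimum degree at least `εn`
and bipartite independence number `α*(G) < αn` (i.e., between any two disjoint equal-size
vertex sets of size at least `αn` there is an edge) contains every tree on `n` vertices with
maximum degree at most `Δ` as a subgraph. -/
theorem spanning_trees_no_large_bipartite_holes
    (ε : ℝ) (hε : 0 < ε) (Δ : ℕ) (hΔ : 0 < Δ) :
    ∃ α : ℝ, 0 < α ∧ ∃ n₀ : ℕ, ∀ n : ℕ, n₀ ≤ n →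
      ∀ G : SimpleGraph (Fin n),
        (∀ v, ε * n ≤ ((G.neighborSet v).ncard : ℝ)) →
        (∀ S T : Finset (Fin n), Disjoint S T → S.card = T.card →
          α * n ≤ (S.card : ℝ) → ∃ s ∈ S, ∃ t ∈ T, G.Adj s t) →
        ∀ T : SimpleGraph (Fin n), T.IsTree →
          (∀ v, (T.neighborSet v).ncard ≤ Δ) →
          ∃ f : Fin n → Fin n, Function.Injective f ∧
            ∀ u v, T.Adj u v → G.Adj (f u) (f v) := by
  exact ST.main_aux ε hε Δ hΔ
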